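/- Suppose 1 ≤ n < ω, κ is a Π^1_n-indescribable cardinal, and □_n(κ) holds. Then there exist two Π^1_n-indescribable sets S_0, S_1 ⊆ κ that do not reflect simultaneously; that is, there is no β < κ such that S_0 ∩ β and S_1 ∩ β are both Π^1_n-indescribable subsets of β. -/

import Mathlib

namespace LCI

/-- `κ` is (the initial ordinal of) a regular uncountable cardinal. -/
def RegUncountable (kappa : Ordinal.{0}) : Prop :=
  Ordinal.omega0 < kappa ∧ kappa.cof.ord = kappa

/-- `C` is a club (closed unbounded) subset of the ordinal `κ`. -/
def IsClubIn (C : Set Ordinal.{0}) (kappa : Ordinal.{0}) : Prop :=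
  C ⊆ Set.Iio kappa ∧
  (∀ alpha < kappa, ∃ beta ∈ C, alpha < beta) ∧
  ∀ beta < kappa, beta ≠ 0 →
    (∀ gamma < beta, ∃ delta ∈ C, gamma < delta ∧ delta < beta) → beta ∈ C

/-- `S` is a stationary subset of the ordinal `κ`. -/
def IsStationaryIn (S : Set Ordinal.{0}) (kappa : Ordinal.{0}) : Prop :=
  S ⊆ Set.Iio kappa ∧ ∀ C, IsClubIn C kappa → (S ∩ C).Nonempty

/-- `H` is homogeneous for the list `L` (where `L α ⊆ α` on the relevant domain):
whenever `α < β` are both in `H`, `L α = L β ∩ α`. -/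
def Homog (L : Ordinal.{0} → Set Ordinal.{0}) (H : Set Ordinal.{0}) : Prop :=
  ∀ alpha ∈ H, ∀ beta ∈ H, alpha < beta → L alpha = L beta ∩ Set.Iio alpha

/-- `S ⊆ κ` is a subtle subset of `κ`: for every `S`-list `L` (i.e. `L α ⊆ α` for
`α ∈ S`) and every club `C ⊆ κ` there are `α < β` in `S ∩ C` with `L α = L β ∩ α`. -/
def IsSubtleIn (S : Set Ordinal.{0}) (kappa : Ordinal.{0}) : Prop :=
  S ⊆ Set.Iio kappa ∧
  ∀ L : Ordinal.{0} → Set Ordinal.{0}, (∀ alpha ∈ S, L alpha ⊆ Set.Iio alpha) →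
    ∀ C, IsClubIn C kappa →
      ∃ alpha ∈ S ∩ C, ∃ beta ∈ S ∩ C, alpha < beta ∧ L alpha = L beta ∩ Set.Iio alpha

/-- Second-order formulas over a structure `(M, ∈, A)` where `M` is a set of sets:
de Bruijn indexed first-order variables and second-order (subset) variables,
a binary membership relation, and a unary predicate for `A`. -/
inductive SOForm : Type where
  | mem : ℕ → ℕ → SOForm
  | app : ℕ → ℕ → SOForm
  | inA : ℕ → SOForm
  | not : SOForm → SOForm
  | and : SOForm → SOForm → SOForm
  | fall : SOForm → SOForm
  | sall : SOForm → SOForm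

/-- Prepend a value to a valuation (de Bruijn style). -/
def consVal {alpha : Type 1} (x : alpha) (v : ℕ → alpha) : ℕ → alpha
  | 0 => x
  | n + 1 => v n

/-- Satisfaction of a second-order formula in the structure `(M, ∈, A)`,
relative to first- and second-order valuations; first-order quantifiers range
over `M` and second-order quantifiers range over subsets of `M`. -/
def SOSat (M A : Set ZFSet.{0}) : SOForm → (ℕ → ZFSet.{0}) → (ℕ → Set ZFSet.{0}) → Prop
  | .mem i j, v, _ => v i ∈ v j
  | .app i j, v, w => v j ∈ w i
  | .inA i, v, _ => v i ∈ A
  | .not phi, v, w => ¬ SOSat M A phi v w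
  | .and phi psi, v, w => SOSat M A phi v w ∧ SOSat M A psi v w
  | .fall phi, v, w => ∀ x ∈ M, SOSat M A phi (consVal x v) w
  | .sall phi, v, w => ∀ P : Set ZFSet.{0}, P ⊆ M → SOSat M A phi v (consVal P w)

/-- A formula is first-order if it contains no second-order quantifier. -/
def SOForm.FO : SOForm → Prop
  | .not phi => phi.FO
  | .and phi psi => phi.FO ∧ psi.FO
  | .fall phi => phi.FO
  | .sall _ => False
  | _ => True

mutual
  /-- `IsPiForm n φ` : `φ` is a `Π¹ₙ` formula. -/
  inductive IsPiForm : ℕ → SOForm → Prop where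
    | fo {phi : SOForm} : phi.FO → IsPiForm 0 phi
    | up {n : ℕ} {phi : SOForm} : IsSigmaForm n phi → IsPiForm (n + 1) phi
    | all {n : ℕ} {phi : SOForm} : IsPiForm (n + 1) phi → IsPiForm (n + 1) (SOForm.sall phi)
  /-- `IsSigmaForm n φ` : `φ` is a `Σ¹ₙ` formula. -/
  inductive IsSigmaForm : ℕ → SOForm → Prop where
    | fo {phi : SOForm} : phi.FO → IsSigmaForm 0 phi
    | up {n : ℕ} {phi : SOForm} : IsPiForm n phi → IsSigmaForm (n + 1) phi
    | ex {n : ℕ} {phi : SOForm} : IsSigmaForm (n + 1) phi →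
        IsSigmaForm (n + 1) (SOForm.not (SOForm.sall (SOForm.not phi)))
end

/-- Satisfaction of a sentence: satisfaction under the default valuations. -/
def SOSatS (M A : Set ZFSet.{0}) (phi : SOForm) : Prop :=
  SOSat M A phi (fun _ => ∅) (fun _ => ∅)

/-- The rank-initial segment `V_α` of the set-theoretic universe. -/
def Vrank (alpha : Ordinal.{0}) : Set ZFSet.{0} := {x | ZFSet.rank x < alpha}

/-- `X ⊆ κ` is a `Π¹ₙ`-indescribable subset of `κ` : for every `A ⊆ V_κ` and every
`Π¹ₙ` sentence `φ`, if `(V_κ, ∈, A) ⊨ φ` then `(V_ξ, ∈, A ∩ V_ξ) ⊨ φ` for some `ξ ∈ X`. -/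
def PiIndesc (n : ℕ) (X : Set Ordinal.{0}) (kappa : Ordinal.{0}) : Prop :=
  X ⊆ Set.Iio kappa ∧
  ∀ A : Set ZFSet.{0}, A ⊆ Vrank kappa → ∀ phi : SOForm, IsPiForm n phi →
    SOSatS (Vrank kappa) A phi → ∃ xi ∈ X, SOSatS (Vrank xi) (A ∩ Vrank xi) phi

/-- `α` is a `Π¹ₘ`-indescribable cardinal. -/
def PiIndCard (m : ℕ) (alpha : Ordinal.{0}) : Prop := PiIndesc m (Set.Iio alpha) alpha

/-- The trace `Tr_m(κ)` : the set of `Π¹ₘ`-indescribable cardinals below `κ`. -/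
def TrSet (m : ℕ) (kappa : Ordinal.{0}) : Set Ordinal.{0} :=
  {alpha | alpha < kappa ∧ PiIndCard m alpha}

/-- `C` is an `n`-club subset of `α` : `C` is `Π¹_{n-1}`-indescribable in `α` and for
every `Π¹_{n-1}`-indescribable `β < α`, if `C ∩ β` is `Π¹_{n-1}`-indescribable in `β`
then `β ∈ C`. -/
def IsNClub (n : ℕ) (C : Set Ordinal.{0}) (alpha : Ordinal.{0}) : Prop :=
  PiIndesc (n - 1) C alpha ∧
  ∀ beta < alpha, PiIndCard (n - 1) beta →
    PiIndesc (n - 1) (C ∩ Set.Iio beta) beta → beta ∈ C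

/-- `⟨C α : α ∈ Tr_{n-1}(κ)⟩` is a coherent sequence of `n`-clubs. -/
def CoherentNClubs (n : ℕ) (kappa : Ordinal.{0}) (C : Ordinal.{0} → Set Ordinal.{0}) : Prop :=
  (∀ alpha ∈ TrSet (n - 1) kappa, IsNClub n (C alpha) alpha) ∧
  ∀ alpha ∈ TrSet (n - 1) kappa, ∀ beta ∈ TrSet (n - 1) kappa, alpha < beta →
    PiIndesc (n - 1) (C beta ∩ Set.Iio alpha) alpha → C alpha = C beta ∩ Set.Iio alpha

/-- `D` is a thread through the coherent sequence `C`. -/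
def IsThread (n : ℕ) (kappa : Ordinal.{0}) (C : Ordinal.{0} → Set Ordinal.{0})
    (D : Set Ordinal.{0}) : Prop :=
  IsNClub n D kappa ∧
  ∀ alpha ∈ TrSet (n - 1) kappa,
    PiIndesc (n - 1) (D ∩ Set.Iio alpha) alpha → C alpha = D ∩ Set.Iio alpha

/-- `□ₙ(κ)` : there is a coherent sequence of `n`-clubs on `κ` with no thread. -/
def SquareN (n : ℕ) (kappa : Ordinal.{0}) : Prop :=
  ∃ C : Ordinal.{0} → Set Ordinal.{0}, CoherentNClubs n kappa C ∧ ∀ D, ¬ IsThread n kappa C D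

section Rank

open Order ZFSet

theorem mem_Vrank {x : ZFSet.{0}} {a : Ordinal.{0}} : x ∈ Vrank a ↔ x.rank < a := Iff.rfl

theorem Vrank_mono {a b : Ordinal.{0}} (h : a ≤ b) : Vrank a ⊆ Vrank b :=
  fun _ hx => lt_of_lt_of_le hx h

theorem Vrank_trans {x y : ZFSet.{0}} {a : Ordinal.{0}} (h : x ∈ y) (hy : y ∈ Vrank a) :
    x ∈ Vrank a := (rank_lt_of_mem h).trans hy

theorem Vrank_inter {a b : Ordinal.{0}} (h : a ≤ b) (A : Set ZFSet.{0}) :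
    (A ∩ Vrank b) ∩ Vrank a = A ∩ Vrank a := by
  rw [Set.inter_assoc, Set.inter_eq_right.2 (Vrank_mono h)]

theorem rank_zfpair (x y : ZFSet.{0}) :
    (pair x y).rank = succ (succ (max x.rank y.rank)) := by
  simp only [pair, rank_insert, rank_singleton]
  rcases le_total x.rank y.rank with h | h
  · simp [h]
  · simp [h]

theorem pair_mem_Vrank {g : Ordinal.{0}} (hg : IsSuccLimit g) {x y : ZFSet.{0}} :
    pair x y ∈ Vrank g ↔ x ∈ Vrank g ∧ y ∈ Vrank g := by
  simp only [mem_Vrank, rank_zfpair, hg.succ_lt_iff, max_lt_iff]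

theorem coe_vonNeumann (a : Ordinal.{0}) : {x | x ∈ vonNeumann a} = Vrank a := by
  ext x; exact mem_vonNeumann

theorem vonNeumann_mem_Vrank {a g : Ordinal.{0}} : vonNeumann a ∈ Vrank g ↔ a < g := by
  rw [mem_Vrank, rank_vonNeumann]

theorem empty_mem_Vrank {g : Ordinal.{0}} (hg : 0 < g) : (∅ : ZFSet.{0}) ∈ Vrank g := by
  rwa [mem_Vrank, rank_empty]

theorem pos_of_isSuccLimit {g : Ordinal.{0}} (hg : IsSuccLimit g) : 0 < g :=
  pos_iff_ne_zero.2 hg.ne_bot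

theorem isSuccLimit_iff_Vrank {g : Ordinal.{0}} :
    IsSuccLimit g ↔ (∃ x, x ∈ Vrank g) ∧ ∀ x ∈ Vrank g, ∃ y ∈ Vrank g, x ∈ y := by
  constructor
  · intro h
    refine ⟨⟨∅, empty_mem_Vrank (pos_of_isSuccLimit h)⟩, fun x hx => ⟨{x}, ?_, by simp⟩⟩
    rw [mem_Vrank, rank_singleton]
    exact h.succ_lt hx
  · rintro ⟨⟨x, hx⟩, h⟩
    have h0 : g ≠ 0 := by rintro rfl; exact not_lt_zero (show x.rank < 0 from hx)
    rw [Ordinal.isSuccLimit_iff]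
    refine ⟨h0, isSuccPrelimit_of_succ_lt fun a ha => ?_⟩
    obtain ⟨y, hy, hay⟩ := h (vonNeumann a) (vonNeumann_mem_Vrank.2 ha)
    have := rank_lt_of_mem hay
    rw [rank_vonNeumann] at this
    exact (succ_le_of_lt this).trans_lt hy

end Rank

section Definability

open Order ZFSet

/-- Predicates of a structure `(V_γ, ∈, A)` together with first- and second-order valuations. -/
abbrev SOPred : Type 1 :=
  Ordinal.{0} → Set ZFSet.{0} → (ℕ → ZFSet.{0}) → (ℕ → Set ZFSet.{0}) → Prop

theorem consVal_mem {M : Set ZFSet.{0}} {x : ZFSet.{0}} {v : ℕ → ZFSet.{0}} (hx : x ∈ M)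
    (hv : ∀ i, v i ∈ M) : ∀ i, consVal x v i ∈ M
  | 0 => hx
  | i + 1 => hv i

theorem consVal_comp {α : Type 1} (x : α) (v : ℕ → α) (r : ℕ → ℕ) :
    (fun i => consVal x v (Nat.casesOn i 0 fun j => r j + 1)) = consVal x fun i => v (r i) := by
  funext i; cases i <;> rfl

/-- `R` is first-order definable, uniformly over the `V_γ` with `γ` limit. -/
def FODef (R : SOPred) : Prop :=
  ∃ phi : SOForm, phi.FO ∧ ∀ g, IsSuccLimit g → ∀ A v w, (∀ i, v i ∈ Vrank g) →
    (SOSat (Vrank g) A phi v w ↔ R g A v w)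

namespace FODef

theorem congr {R R' : SOPred} (h : FODef R)
    (hR : ∀ g, IsSuccLimit g → ∀ A v w, (∀ i, v i ∈ Vrank g) → (R g A v w ↔ R' g A v w)) :
    FODef R' := by
  obtain ⟨phi, h1, h2⟩ := h
  exact ⟨phi, h1, fun g hg A v w hv => (h2 g hg A v w hv).trans (hR g hg A v w hv)⟩

theorem mem (i j : ℕ) : FODef fun _ _ v _ => v i ∈ v j :=
  ⟨.mem i j, trivial, fun _ _ _ _ _ _ => Iff.rfl⟩

theorem app (i j : ℕ) : FODef fun _ _ v w => v j ∈ w i :=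
  ⟨.app i j, trivial, fun _ _ _ _ _ _ => Iff.rfl⟩

theorem inA (i : ℕ) : FODef fun _ A v _ => v i ∈ A :=
  ⟨.inA i, trivial, fun _ _ _ _ _ _ => Iff.rfl⟩

theorem not {R : SOPred} (h : FODef R) : FODef fun g A v w => ¬ R g A v w := by
  obtain ⟨phi, h1, h2⟩ := h
  exact ⟨.not phi, h1, fun g hg A v w hv => not_congr (h2 g hg A v w hv)⟩

theorem and {R Q : SOPred} (h : FODef R) (k : FODef Q) :
    FODef fun g A v w => R g A v w ∧ Q g A v w := by
  obtain ⟨phi, h1, h2⟩ := h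
  obtain ⟨psi, k1, k2⟩ := k
  exact ⟨.and phi psi, ⟨h1, k1⟩, fun g hg A v w hv =>
    and_congr (h2 g hg A v w hv) (k2 g hg A v w hv)⟩

theorem or {R Q : SOPred} (h : FODef R) (k : FODef Q) :
    FODef fun g A v w => R g A v w ∨ Q g A v w :=
  (h.not.and k.not).not.congr fun _ _ _ _ _ _ => by tauto

theorem imp {R Q : SOPred} (h : FODef R) (k : FODef Q) :
    FODef fun g A v w => R g A v w → Q g A v w :=
  (h.and k.not).not.congr fun _ _ _ _ _ _ => by tauto

theorem iff {R Q : SOPred} (h : FODef R) (k : FODef Q) :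
    FODef fun g A v w => (R g A v w ↔ Q g A v w) :=
  ((h.imp k).and (k.imp h)).congr fun _ _ _ _ _ _ => by tauto

theorem fall {R : SOPred} (h : FODef R) :
    FODef fun g A v w => ∀ x ∈ Vrank g, R g A (consVal x v) w := by
  obtain ⟨phi, h1, h2⟩ := h
  exact ⟨.fall phi, h1, fun g hg A v w hv =>
    forall₂_congr fun x hx => h2 g hg A _ w (consVal_mem hx hv)⟩

theorem ex {R : SOPred} (h : FODef R) :
    FODef fun g A v w => ∃ x ∈ Vrank g, R g A (consVal x v) w :=
  h.not.fall.not.congr fun _ _ _ _ _ _ => by push Not; rfl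

theorem eq (i j : ℕ) : FODef fun _ _ v _ => v i = v j :=
  ((mem 0 (i + 1)).iff (mem 0 (j + 1))).fall.congr fun g _ _ v _ hv => by
    refine ⟨fun h => ?_, fun h x _ => ?_⟩
    · ext z
      exact ⟨fun hz => (h z (Vrank_trans hz (hv i))).1 hz,
        fun hz => (h z (Vrank_trans hz (hv j))).2 hz⟩
    · change x ∈ v i ↔ x ∈ v j
      rw [h]

theorem eq_pair (i j k : ℕ) : FODef fun _ _ v _ => v i = pair (v j) (v k) := by
  have h := ((mem 0 (i + 1)).iff
    (((mem 0 1).iff (eq 0 (j + 2))).fall.or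
      ((mem 0 1).iff ((eq 0 (j + 2)).or (eq 0 (k + 2)))).fall)).fall
  refine h.congr fun g hg A v w hv => ?_
  have key : ∀ u ∈ Vrank g, ((∀ z ∈ Vrank g, z ∈ u ↔ z = v j) ∨
      (∀ z ∈ Vrank g, z ∈ u ↔ z = v j ∨ z = v k)) ↔ u ∈ pair (v j) (v k) := by
    intro u hu
    rw [pair, ZFSet.mem_pair]
    refine or_congr ⟨fun h => ?_, ?_⟩ ⟨fun h => ?_, ?_⟩
    · ext z
      rw [mem_singleton]
      exact ⟨fun hz => (h z (Vrank_trans hz hu)).1 hz, fun hz => (h z (hz ▸ hv j)).2 hz⟩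
    · rintro rfl z -
      rw [mem_singleton]
    · ext z
      rw [ZFSet.mem_pair]
      refine ⟨fun hz => (h z (Vrank_trans hz hu)).1 hz, fun hz => (h z ?_).2 hz⟩
      rcases hz with rfl | rfl
      · exact hv j
      · exact hv k
    · rintro rfl z -
      rw [ZFSet.mem_pair]
  constructor
  · intro h
    ext u
    constructor
    · intro hu
      have hu' := Vrank_trans hu (hv i)
      exact (key u hu').1 ((h u hu').1 hu)
    · intro hu
      have hu' := Vrank_trans hu ((pair_mem_Vrank hg).2 ⟨hv j, hv k⟩)
      exact (h u hu').2 ((key u hu').2 hu)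
  · intro h u hu
    change u ∈ v i ↔ _
    rw [h]
    exact (key u hu).symm

theorem pair_app (s i j : ℕ) : FODef fun _ _ v w => pair (v i) (v j) ∈ w s :=
  ((eq_pair 0 (i + 1) (j + 1)).and (app s 0)).ex.congr fun g hg A v w hv => by
    refine ⟨?_, fun h => ⟨_, (pair_mem_Vrank hg).2 ⟨hv i, hv j⟩, rfl, h⟩⟩
    rintro ⟨x, -, h1, h2⟩
    change x = pair (v i) (v j) at h1
    exact h1 ▸ h2

theorem pair_inA (i j : ℕ) : FODef fun _ A v _ => pair (v i) (v j) ∈ A :=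
  ((eq_pair 0 (i + 1) (j + 1)).and (inA 0)).ex.congr fun g hg A v w hv => by
    refine ⟨?_, fun h => ⟨_, (pair_mem_Vrank hg).2 ⟨hv i, hv j⟩, rfl, h⟩⟩
    rintro ⟨x, -, h1, h2⟩
    change x = pair (v i) (v j) at h1
    exact h1 ▸ h2

end FODef

/-- Interpretation of an optional source for the distinguished predicate. -/
def predSource (A : Set ZFSet.{0}) (w : ℕ → Set ZFSet.{0}) : Option ℕ → Set ZFSet.{0}
  | none => A
  | some s => w s

/-- Rename second-order variables along `r`, and possibly replace the distinguished predicate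
by a second-order variable. -/
def SOForm.ren : SOForm → (ℕ → ℕ) → Option ℕ → SOForm
  | .mem i j, _, _ => .mem i j
  | .app i j, r, _ => .app (r i) j
  | .inA i, _, none => .inA i
  | .inA i, _, some s => .app s i
  | .not phi, r, o => .not (phi.ren r o)
  | .and phi psi, r, o => .and (phi.ren r o) (psi.ren r o)
  | .fall phi, r, o => .fall (phi.ren r o)
  | .sall phi, _, _ => .sall phi

theorem SOForm.FO.ren {phi : SOForm} (h : phi.FO) (r : ℕ → ℕ) (o : Option ℕ) :
    (phi.ren r o).FO := by
  induction phi with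
  | mem i j => trivial
  | app i j => trivial
  | inA i => cases o <;> trivial
  | not phi ih => exact ih h
  | and phi psi ih1 ih2 => exact ⟨ih1 h.1, ih2 h.2⟩
  | fall phi ih => exact ih h
  | sall phi => exact h.elim

theorem SOForm.FO.sat_ren {phi : SOForm} (h : phi.FO) (r : ℕ → ℕ) (o : Option ℕ)
    (M A : Set ZFSet.{0}) (v : ℕ → ZFSet.{0}) (w : ℕ → Set ZFSet.{0}) :
    SOSat M A (phi.ren r o) v w ↔ SOSat M (predSource A w o) phi v fun i => w (r i) := by
  induction phi generalizing v with
  | mem i j => rfl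
  | app i j => rfl
  | inA i => cases o <;> rfl
  | not phi ih => exact not_congr (ih h v)
  | and phi psi ih1 ih2 => exact and_congr (ih1 h.1 v) (ih2 h.2 v)
  | fall phi ih => exact forall₂_congr fun x _ => ih h _
  | sall phi => exact h.elim

theorem FODef.ren {R : SOPred} (h : FODef R) (r : ℕ → ℕ) (o : Option ℕ) :
    FODef fun g A v w => R g (predSource A w o) v fun i => w (r i) := by
  obtain ⟨phi, h1, h2⟩ := h
  exact ⟨phi.ren r o, h1.ren r o, fun g hg A v w hv =>
    (h1.sat_ren r o _ A v w).trans (h2 g hg _ v _ hv)⟩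

theorem FODef.lift {R : SOPred} (h : FODef R) :
    FODef fun g A v w => R g A v fun i => w (i + 1) := h.ren Nat.succ none

/-- `PiDef n R` : `R` is `Π¹ₙ`-definable, uniformly over the `V_γ` with `γ` limit. -/
inductive PiDef : ℕ → SOPred → Prop
  | fo {R : SOPred} : FODef R → PiDef 0 R
  | neg {n : ℕ} {R : SOPred} : PiDef n R → PiDef (n + 1) fun g A v w => ¬ R g A v w
  | all {n : ℕ} {R : SOPred} : PiDef (n + 1) R →
      PiDef (n + 1) fun g A v w => ∀ X ⊆ Vrank g, R g A v (consVal X w)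
  | congr {n : ℕ} {R R' : SOPred} : PiDef n R →
      (∀ g, IsSuccLimit g → ∀ A v w, (∀ i, v i ∈ Vrank g) → (R g A v w ↔ R' g A v w)) →
      PiDef n R'

namespace PiDef

theorem ofFO {R : SOPred} (h : FODef R) : ∀ n, PiDef n R
  | 0 => .fo h
  | n + 1 => (PiDef.neg (ofFO h.not n)).congr fun _ _ _ _ _ _ => not_not

theorem and_or_fo {n : ℕ} {R : SOPred} (h : PiDef n R) : ∀ {Q : SOPred}, FODef Q →
    PiDef n (fun g A v w => R g A v w ∧ Q g A v w) ∧
      PiDef n (fun g A v w => R g A v w ∨ Q g A v w) := by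
  induction h with
  | fo h => exact fun k => ⟨.fo (h.and k), .fo (h.or k)⟩
  | neg h ih =>
    refine fun k => ⟨(PiDef.neg (ih k.not).2).congr fun _ _ _ _ _ _ => ?_,
      (PiDef.neg (ih k.not).1).congr fun _ _ _ _ _ _ => ?_⟩ <;> tauto
  | all h ih =>
    refine fun {Q} k => ⟨(PiDef.all (ih k.lift).1).congr fun g _ A v w _ => ?_,
      (PiDef.all (ih k.lift).2).congr fun g _ A v w _ => ?_⟩
    · exact ⟨fun H => ⟨fun X hX => (H X hX).1, (H ∅ (Set.empty_subset _)).2⟩,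
        fun H X hX => ⟨H.1 X hX, H.2⟩⟩
    · change (∀ X ⊆ Vrank g, _ ∨ Q g A v w) ↔ _
      by_cases hQ : Q g A v w <;> simp [hQ]
  | congr h hR ih =>
    exact fun k => ⟨(ih k).1.congr fun g hg A v w hv => and_congr_left' (hR g hg A v w hv),
      (ih k).2.congr fun g hg A v w hv => or_congr_left (hR g hg A v w hv)⟩

theorem ren {n : ℕ} {R : SOPred} (h : PiDef n R) : ∀ (r : ℕ → ℕ) (o : Option ℕ),
    PiDef n fun g A v w => R g (predSource A w o) v fun i => w (r i) := by
  induction h with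
  | fo h => exact fun r o => .fo (h.ren r o)
  | neg h ih => exact fun r o => .neg (ih r o)
  | @all n R h ih =>
    intro r o
    refine (PiDef.all (ih (fun i => Nat.casesOn i 0 fun j => r j + 1) (o.map Nat.succ))).congr
      fun g _ A v w _ => forall₂_congr fun X _ => ?_
    rw [consVal_comp]
    cases o <;> rfl
  | congr h hR ih =>
    exact fun r o => (ih r o).congr fun g hg A v w hv => hR g hg _ v _ hv

end PiDef

/-- The sentence expressing that `V_γ` has limit height. -/
def limitForm : SOForm :=
  .and (.not (.fall (.not (.not (.and (.mem 0 0) (.not (.mem 0 0)))))))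
    (.fall (.not (.fall (.not (.mem 1 0)))))

theorem sat_limitForm (g : Ordinal.{0}) (A : Set ZFSet.{0}) (v : ℕ → ZFSet.{0})
    (w : ℕ → Set ZFSet.{0}) : SOSat (Vrank g) A limitForm v w ↔ IsSuccLimit g := by
  rw [isSuccLimit_iff_Vrank]
  simp [limitForm, SOSat, consVal]

/-- `phi` represents `R` over limit `V_γ`, and fails at all other `V_γ`. -/
def Represents (phi : SOForm) (R : SOPred) : Prop :=
  (∀ g, IsSuccLimit g → ∀ A v w, (∀ i, v i ∈ Vrank g) →
    (SOSat (Vrank g) A phi v w ↔ R g A v w)) ∧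
  ∀ g, ¬ IsSuccLimit g → ∀ A v w, ¬ SOSat (Vrank g) A phi v w

theorem FODef.exists_represents {R : SOPred} (h : FODef R) :
    ∃ phi : SOForm, phi.FO ∧ Represents phi R := by
  obtain ⟨phi, h1, h2⟩ := h
  refine ⟨.and phi limitForm, ⟨h1, by simp [limitForm, SOForm.FO]⟩,
    fun g hg A v w hv => ?_, fun g hg A v w h => ?_⟩
  · rw [← h2 g hg A v w hv]
    exact and_iff_left ((sat_limitForm g A v w).2 hg)
  · exact hg ((sat_limitForm g A v w).1 h.2)

theorem PiDef.exists_pi_sigma {n : ℕ} {R : SOPred} (h : PiDef n R) :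
    (∃ phi, IsPiForm n phi ∧ Represents phi R) ∧
      ∃ phi, IsSigmaForm n phi ∧ Represents phi fun g A v w => ¬ R g A v w := by
  induction h with
  | fo h =>
    obtain ⟨phi, h1, h2⟩ := h.exists_represents
    obtain ⟨psi, k1, k2⟩ := h.not.exists_represents
    exact ⟨⟨phi, .fo h1, h2⟩, psi, .fo k1, k2⟩
  | neg h ih =>
    obtain ⟨⟨phi, h1, h2⟩, psi, k1, k2⟩ := ih
    refine ⟨⟨psi, .up k1, k2⟩, phi, .up h1, fun g hg A v w hv =>
      (h2.1 g hg A v w hv).trans not_not.symm, h2.2⟩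
  | all h ih =>
    obtain ⟨⟨phi, h1, h2⟩, psi, k1, k2⟩ := ih
    refine ⟨⟨.sall phi, .all h1, fun g hg A v w hv =>
        forall₂_congr fun X _ => h2.1 g hg A v _ hv, fun g hg A v w H =>
        h2.2 g hg A v _ (H ∅ (Set.empty_subset _))⟩,
      .not (.sall (.not psi)), .ex k1, fun g hg A v w hv => not_congr <|
        forall₂_congr fun X _ => (not_congr (k2.1 g hg A v _ hv)).trans not_not,
      fun g hg A v w H => H fun X _ => k2.2 g hg A v _⟩
  | congr h hR ih =>
    obtain ⟨⟨phi, h1, h2⟩, psi, k1, k2⟩ := ih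
    exact ⟨⟨phi, h1, fun g hg A v w hv => (h2.1 g hg A v w hv).trans (hR g hg A v w hv), h2.2⟩,
      psi, k1, fun g hg A v w hv => (k2.1 g hg A v w hv).trans (not_congr (hR g hg A v w hv)),
      k2.2⟩

/-- A `Π¹ₙ`-definable property of structures `(V_γ, ∈, A)` is given by a `Π¹ₙ` sentence. -/
theorem PiDef.exists_sentence {n : ℕ} {R : Ordinal.{0} → Set ZFSet.{0} → Prop}
    (h : PiDef n fun g A _ _ => R g A) :
    ∃ phi, IsPiForm n phi ∧ ∀ g A, SOSatS (Vrank g) A phi ↔ IsSuccLimit g ∧ R g A := by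
  obtain ⟨⟨phi, h1, h2⟩, -⟩ := h.exists_pi_sigma
  refine ⟨phi, h1, fun g A => ?_⟩
  by_cases hg : IsSuccLimit g
  · rw [and_iff_right hg]
    exact h2.1 g hg A _ _ fun _ => empty_mem_Vrank (pos_of_isSuccLimit hg)
  · exact ⟨fun H => (h2.2 g hg A _ _ H).elim, fun H => (hg H.1).elim⟩

end Definability

section Inaccessible

open Order ZFSet

/-- Second-order replacement in `V_γ`, for the relation coded by `F`. -/
def CollectionFor (g : Ordinal.{0}) (F : Set ZFSet.{0}) : Prop :=
  ∀ s ∈ Vrank g, ∃ t ∈ Vrank g, ∀ x ∈ Vrank g, x ∈ s →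
    (∃ y ∈ Vrank g, pair x y ∈ F) → ∃ y ∈ Vrank g, y ∈ t ∧ pair x y ∈ F

/-- `γ > ω` is a limit ordinal such that `V_γ` satisfies second-order replacement. -/
def Inacc (g : Ordinal.{0}) : Prop :=
  IsSuccLimit g ∧ Ordinal.omega0 < g ∧ ∀ F ⊆ Vrank g, CollectionFor g F

theorem omega0_lt_iff {g : Ordinal.{0}} :
    Ordinal.omega0 < g ↔ ∃ x ∈ Vrank g, (∃ y ∈ Vrank g, y ∈ x) ∧
      ∀ y ∈ Vrank g, y ∈ x → ∃ z ∈ Vrank g, z ∈ x ∧ y ∈ z := by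
  constructor
  · intro h
    refine ⟨vonNeumann Ordinal.omega0, vonNeumann_mem_Vrank.2 h,
      ⟨∅, empty_mem_Vrank (Ordinal.omega0_pos.trans h), ?_⟩, fun y hy hyx => ?_⟩
    · rw [mem_vonNeumann, rank_empty]
      exact Ordinal.omega0_pos
    · rw [mem_vonNeumann] at hyx
      have h1 : ({y} : ZFSet).rank < Ordinal.omega0 := by
        rw [rank_singleton]
        exact Ordinal.isSuccLimit_omega0.succ_lt hyx
      exact ⟨{y}, h1.trans h, mem_vonNeumann.2 h1, mem_singleton.2 rfl⟩
  · rintro ⟨x, hx, ⟨y, -, hy⟩, h⟩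
    have key : ∀ n : ℕ, ∃ y ∈ x, (n : Ordinal.{0}) ≤ y.rank := by
      intro n
      induction n with
      | zero => exact ⟨y, hy, by simp⟩
      | succ n ih =>
        obtain ⟨z, hz, hn⟩ := ih
        obtain ⟨z', -, hz', hzz⟩ := h z (Vrank_trans hz hx) hz
        refine ⟨z', hz', ?_⟩
        have := succ_le_of_lt (hn.trans_lt (rank_lt_of_mem hzz))
        simpa using this
    refine lt_of_le_of_lt (Ordinal.omega0_le.2 fun n => ?_) hx
    obtain ⟨z, hz, hn⟩ := key n
    exact hn.trans (rank_lt_of_mem hz).le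

theorem Inacc.bound {g : Ordinal.{0}} (hg : Inacc g) {s : ZFSet.{0}} (hs : s ∈ Vrank g)
    {f : ZFSet.{0} → Ordinal.{0}} (hf : ∀ x ∈ s, f x < g) : ∃ d < g, ∀ x ∈ s, f x < d := by
  obtain ⟨t, ht, h⟩ := hg.2.2 {z | ∃ x ∈ s, z = pair x (vonNeumann (f x))} (by
    rintro _ ⟨x, hx, rfl⟩
    exact (pair_mem_Vrank hg.1).2 ⟨Vrank_trans hx hs, vonNeumann_mem_Vrank.2 (hf x hx)⟩) s hs
  refine ⟨t.rank, ht, fun x hx => ?_⟩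
  obtain ⟨y, -, hyt, x', -, he⟩ := h x (Vrank_trans hx hs) hx
    ⟨_, vonNeumann_mem_Vrank.2 (hf x hx), x, hx, rfl⟩
  obtain ⟨rfl, rfl⟩ := pair_inj.1 he
  simpa using rank_lt_of_mem hyt

/-- `α` is a nonzero closure point of `f`. -/
def ClosedUnder (a : Ordinal.{0}) (f : Ordinal.{0} → Ordinal.{0}) : Prop :=
  0 < a ∧ ∀ b < a, f b < a

theorem ClosedUnder.mono {a : Ordinal.{0}} {f h : Ordinal.{0} → Ordinal.{0}}
    (ha : ClosedUnder a h) (hf : ∀ b < a, f b ≤ h b) : ClosedUnder a f :=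
  ⟨ha.1, fun b hb => (hf b hb).trans_lt (ha.2 b hb)⟩

theorem ClosedUnder.isSuccLimit {a : Ordinal.{0}} (h : ClosedUnder a succ) : IsSuccLimit a := by
  rw [Ordinal.isSuccLimit_iff]
  exact ⟨h.1.ne', isSuccPrelimit_of_succ_lt h.2⟩

theorem Inacc.exists_closedUnder {g : Ordinal.{0}} (hg : Inacc g)
    {f : Ordinal.{0} → Ordinal.{0}} (hf : ∀ b < g, f b < g) : ∃ a < g, ClosedUnder a f := by
  have step : ∀ d : Set.Iio g, ∃ e : Set.Iio g, d.1 < e.1 ∧ ∀ b < d.1, f b < e.1 := by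
    rintro ⟨d, hd⟩
    obtain ⟨e, he, h⟩ := hg.bound (vonNeumann_mem_Vrank.2 hd) (f := fun x => f x.rank)
      fun x hx => hf _ ((mem_vonNeumann.1 hx).trans hd)
    refine ⟨⟨max e (succ d), max_lt he (hg.1.succ_lt hd)⟩,
      (lt_succ d).trans_le (le_max_right _ _), fun b hb => ?_⟩
    have := h (vonNeumann b) (mem_vonNeumann.2 (by rwa [rank_vonNeumann]))
    rw [rank_vonNeumann] at this
    exact this.trans_le (le_max_left _ _)
  choose e he1 he2 using step
  let c : ℕ → Set.Iio g := fun k => e^[k] ⟨0, pos_of_isSuccLimit hg.1⟩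
  have hc : ∀ k, c (k + 1) = e (c k) := fun k => Function.iterate_succ_apply' e k _
  have hle : ∀ k, (c k).1 ≤ ⨆ k, (c k).1 := fun k => Ordinal.le_iSup (fun k => (c k).1) k
  obtain ⟨d, hd, hcd⟩ := hg.bound (vonNeumann_mem_Vrank.2 hg.2.1)
    (f := fun x => sInf {b | ∃ k : ℕ, x.rank = k ∧ b = (c k).1}) fun x hx => by
      obtain ⟨k, hk⟩ := Ordinal.lt_omega0.1 (mem_vonNeumann.1 hx)
      exact lt_of_le_of_lt (csInf_le' ⟨k, hk, rfl⟩) (c k).2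
  refine ⟨⨆ k, (c k).1, lt_of_le_of_lt (Ordinal.iSup_le fun k => ?_) hd, ?_, fun b hb => ?_⟩
  · have := hcd (vonNeumann k) (mem_vonNeumann.2 (by simp))
    have hs : {b | ∃ j : ℕ, (vonNeumann (k : Ordinal.{0})).rank = j ∧ b = (c j).1} =
        {(c k).1} := by
      ext b
      simp only [rank_vonNeumann, Nat.cast_inj, Set.mem_ofPred_eq, Set.mem_singleton_iff]
      constructor
      · rintro ⟨_, rfl, h⟩
        exact h
      · exact fun h => ⟨k, rfl, h⟩
    rw [hs, csInf_singleton] at this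
    exact this.le
  · have h0 : (c 0).1 < (c 1).1 := by rw [hc]; exact he1 _
    exact (zero_le (a := (c 0).1)).trans_lt (h0.trans_le (hle 1))
  · obtain ⟨k, hk⟩ := Ordinal.lt_iSup_iff.1 hb
    have h1 : f b < (c (k + 1)).1 := by rw [hc]; exact he2 _ b hk
    exact h1.trans_le (hle _)

/-- Code of a sequence of sets. -/
noncomputable def seqCode (v : ℕ → ZFSet.{0}) : ZFSet.{0} :=
  ZFSet.range fun i : ℕ => pair (vonNeumann i) (v i)

theorem pair_mem_seqCode {v : ℕ → ZFSet.{0}} {i : ℕ} {y : ZFSet.{0}} :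
    pair (vonNeumann i) y ∈ seqCode v ↔ y = v i := by
  simp only [seqCode, ZFSet.mem_range, pair_inj, vonNeumann_inj, Nat.cast_inj]
  exact ⟨by rintro ⟨_, rfl, rfl⟩; rfl, fun h => ⟨i, rfl, h.symm⟩⟩

theorem seqCode_injective : Function.Injective seqCode := fun v v' h => by
  funext i
  rw [← pair_mem_seqCode (v := v') (i := i), ← h, pair_mem_seqCode]

theorem rank_seqCode_le {v : ℕ → ZFSet.{0}} {b : Ordinal.{0}} (hv : ∀ i, v i ∈ Vrank b) :
    (seqCode v).rank ≤ succ (succ (max Ordinal.omega0 b)) := by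
  rw [rank_le_iff]
  intro y hy
  obtain ⟨i, rfl⟩ := ZFSet.mem_range.1 hy
  rw [rank_zfpair, succ_lt_succ_iff, succ_lt_succ_iff, rank_vonNeumann]
  exact max_lt_max (Ordinal.natCast_lt_omega0 i) (hv i)

theorem Inacc.bound_seq {g : Ordinal.{0}} (hg : Inacc g) {b : Ordinal.{0}} (hb : b < g)
    {f : (ℕ → ZFSet.{0}) → Ordinal.{0}} (hf : ∀ v, f v < g) :
    ∃ d < g, ∀ v, (∀ i, v i ∈ Vrank b) → f v < d := by
  have hd : succ (succ (succ (max Ordinal.omega0 b))) < g :=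
    hg.1.succ_lt (hg.1.succ_lt (hg.1.succ_lt (max_lt hg.2.1 hb)))
  obtain ⟨d, hd, h⟩ := hg.bound (vonNeumann_mem_Vrank.2 hd)
    (f := fun x => f (Function.invFun seqCode x)) fun _ _ => hf _
  refine ⟨d, hd, fun v hv => ?_⟩
  have := h (seqCode v) (mem_vonNeumann.2 (lt_succ_of_le (rank_seqCode_le hv)))
  rwa [Function.leftInverse_invFun seqCode_injective] at this

/-- Löwenheim–Skolem in `V_γ`: a first-order formula is absolute between `V_α` and `V_γ` for
all `α < γ` closed under a suitable function. -/
theorem Inacc.reflect_fo {g : Ordinal.{0}} (hg : Inacc g) {phi : SOForm} (hphi : phi.FO)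
    (A : Set ZFSet.{0}) (w : ℕ → Set ZFSet.{0}) :
    ∃ f : Ordinal.{0} → Ordinal.{0}, (∀ b < g, f b < g) ∧ ∀ a < g, ClosedUnder a f →
      ∀ b < a, ∀ v, (∀ i, v i ∈ Vrank b) →
        (SOSat (Vrank a) (A ∩ Vrank a) phi v (fun i => w i ∩ Vrank a) ↔
          SOSat (Vrank g) A phi v w) := by
  induction phi with
  | mem i j => exact ⟨id, fun _ h => h, fun _ _ _ _ _ _ _ => Iff.rfl⟩
  | app i j =>
    exact ⟨id, fun _ h => h, fun a _ _ b hb v hv =>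
      and_iff_left (Vrank_mono hb.le (hv j))⟩
  | inA i =>
    exact ⟨id, fun _ h => h, fun a _ _ b hb v hv =>
      and_iff_left (Vrank_mono hb.le (hv i))⟩
  | not phi ih =>
    obtain ⟨f, hf, h⟩ := ih hphi
    exact ⟨f, hf, fun a ha hc b hb v hv => not_congr (h a ha hc b hb v hv)⟩
  | and phi psi ih1 ih2 =>
    obtain ⟨f1, hf1, h1⟩ := ih1 hphi.1
    obtain ⟨f2, hf2, h2⟩ := ih2 hphi.2
    refine ⟨fun b => max (f1 b) (f2 b), fun b hb => max_lt (hf1 b hb) (hf2 b hb),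
      fun a ha hc b hb v hv => and_congr ?_ ?_⟩
    · exact h1 a ha (hc.mono fun _ _ => le_max_left _ _) b hb v hv
    · exact h2 a ha (hc.mono fun _ _ => le_max_right _ _) b hb v hv
  | fall phi ih =>
    obtain ⟨f1, hf1, h1⟩ := ih hphi
    have hwit : ∀ v, ∃ d < g, (∃ x ∈ Vrank g, ¬ SOSat (Vrank g) A phi (consVal x v) w) →
        ∃ x, x.rank = d ∧ ¬ SOSat (Vrank g) A phi (consVal x v) w := by
      intro v
      by_cases h : ∃ x ∈ Vrank g, ¬ SOSat (Vrank g) A phi (consVal x v) w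
      · obtain ⟨x, hx, h'⟩ := h
        exact ⟨x.rank, hx, fun _ => ⟨x, rfl, h'⟩⟩
      · exact ⟨0, pos_of_isSuccLimit hg.1, fun h' => (h h').elim⟩
    choose r hr hr' using hwit
    have hbd : ∀ b, ∃ d, b < g → d < g ∧ ∀ v, (∀ i, v i ∈ Vrank b) → r v < d := by
      intro b
      by_cases hb : b < g
      · obtain ⟨d, hd⟩ := hg.bound_seq hb hr
        exact ⟨d, fun _ => hd⟩
      · exact ⟨0, fun h => (hb h).elim⟩
    choose f2 hf2 using hbd
    refine ⟨fun b => max (f1 b) (max (f2 b) (succ b)), fun b hb =>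
      max_lt (hf1 b hb) (max_lt (hf2 b hb).1 (hg.1.succ_lt hb)), fun a ha hc b hb v hv => ?_⟩
    have hc1 : ClosedUnder a f1 := hc.mono fun _ _ => le_max_left _ _
    have hc2 : ClosedUnder a f2 :=
      hc.mono fun _ _ => (le_max_left _ _).trans (le_max_right _ _)
    have hlim : IsSuccLimit a := ClosedUnder.isSuccLimit <|
      hc.mono fun _ _ => (le_max_right _ _).trans (le_max_right _ _)
    have key : ∀ x ∈ Vrank a,
        (SOSat (Vrank a) (A ∩ Vrank a) phi (consVal x v) (fun i => w i ∩ Vrank a) ↔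
          SOSat (Vrank g) A phi (consVal x v) w) := by
      intro x hx
      refine h1 a ha hc1 (max b (succ x.rank)) (max_lt hb (hlim.succ_lt hx)) _
        (consVal_mem ?_ fun i => Vrank_mono (le_max_left _ _) (hv i))
      exact (lt_succ x.rank).trans_le (le_max_right _ _)
    constructor
    · intro H x hx
      by_contra hcon
      obtain ⟨y, hy, hy'⟩ := hr' v ⟨x, hx, hcon⟩
      have hya : y ∈ Vrank a := by
        rw [mem_Vrank, hy]
        exact ((hf2 b (hb.trans ha)).2 v hv).trans (hc2.2 b hb)
      exact hy' ((key y hya).1 (H y hya))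
    · exact fun H x hx => (key x hx).2 (H x (Vrank_mono ha.le hx))
  | sall phi => exact hphi.elim

theorem FODef.lt_omega : FODef fun g _ _ _ => Ordinal.omega0 < g :=
  (((FODef.mem 0 1).ex).and
    (((FODef.mem 0 1).imp ((FODef.mem 0 2).and (FODef.mem 1 0)).ex).fall)).ex.congr
    fun _ _ _ _ _ _ => omega0_lt_iff.symm

theorem FODef.collectionFor (s : ℕ) : FODef fun g _ _ w => CollectionFor g (w s) := by
  have h1 : FODef fun g _ v w => ∃ y ∈ Vrank g, pair (v 0) y ∈ w s :=
    (FODef.pair_app s 1 0).ex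
  have h2 : FODef fun g _ v w => ∃ y ∈ Vrank g, y ∈ v 1 ∧ pair (v 0) y ∈ w s :=
    ((FODef.mem 0 2).and (FODef.pair_app s 1 0)).ex
  exact ((FODef.mem 0 2).imp (h1.imp h2)).fall.ex.fall

/-- `Π¹ₙ` properties, `n ≥ 1`, are closed under conjunction with inaccessibility. -/
theorem PiDef.and_inacc {n : ℕ} {R : SOPred} (h : PiDef (n + 1) R) :
    PiDef (n + 1) fun g A v w => Inacc g ∧ R g A v w := by
  have h1 := (PiDef.all ((h.ren Nat.succ none).and_or_fo (FODef.collectionFor 0)).1)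
  refine (h1.and_or_fo FODef.lt_omega).1.congr fun g hg A v w _ => ?_
  change (∀ X ⊆ Vrank g, R g A v w ∧ CollectionFor g X) ∧ _ ↔ _
  constructor
  · exact fun H => ⟨⟨hg, H.2, fun F hF => (H.1 F hF).2⟩, (H.1 ∅ (Set.empty_subset _)).1⟩
  · exact fun H => ⟨fun X hX => ⟨H.2, H.1.2.2 X hX⟩, H.1.2.1⟩

end Inaccessible

section NormalForm

mutual

theorem IsPiForm.mono {n : ℕ} {phi : SOForm} : IsPiForm n phi → IsPiForm (n + 1) phi
  | .fo h => .up (.fo h)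
  | .up h => .up h.mono
  | .all h => .all h.mono

theorem IsSigmaForm.mono {n : ℕ} {phi : SOForm} : IsSigmaForm n phi → IsSigmaForm (n + 1) phi
  | .fo h => .up (.fo h)
  | .up h => .up h.mono
  | .ex h => .ex h.mono

end

theorem PiIndesc.pred {n : ℕ} {X : Set Ordinal.{0}} {g : Ordinal.{0}} (h : PiIndesc (n + 1) X g) :
    PiIndesc n X g :=
  ⟨h.1, fun A hA phi hphi => h.2 A hA phi hphi.mono⟩

theorem PiIndesc.of_le {n m : ℕ} {X : Set Ordinal.{0}} {g : Ordinal.{0}} (h : PiIndesc n X g)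
    (hm : m ≤ n) : PiIndesc m X g := by
  induction hm with
  | refl => exact h
  | step _ ih => exact ih h.pred

/-- Prepend the first `k` values of `X` to the valuation `w`. -/
def prepend (k : ℕ) (X w : ℕ → Set ZFSet.{0}) (i : ℕ) : Set ZFSet.{0} :=
  if i < k then X i else w (i - k)

theorem prepend_succ (k : ℕ) (X w : ℕ → Set ZFSet.{0}) :
    prepend (k + 1) X w = prepend k X (consVal (X k) w) := by
  funext i
  unfold prepend
  rcases lt_trichotomy i k with h | rfl | h
  · rw [if_pos (h.trans (Nat.lt_succ_self k)), if_pos h]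
  · simp [consVal]
  · obtain ⟨j, rfl⟩ := Nat.exists_eq_add_of_lt h
    rw [if_neg (by omega), if_neg (by omega), show k + j + 1 - (k + 1) = j by omega,
      show k + j + 1 - k = j + 1 by omega]
    rfl

theorem prepend_congr {k : ℕ} {X Y : ℕ → Set ZFSet.{0}} (h : ∀ i < k, X i = Y i)
    (w : ℕ → Set ZFSet.{0}) : prepend k X w = prepend k Y w := by
  funext i
  unfold prepend
  split_ifs with hi
  · exact h i hi
  · rfl

/-- Satisfaction of a formula `∀ X̄₁ ¬ ∀ X̄₂ ¬ ⋯ ψ` in prenex form, where the `i`-th block of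
quantifiers has the length given by the list. -/
def NFSat (M A : Set ZFSet.{0}) (psi : SOForm) (v : ℕ → ZFSet.{0}) :
    List ℕ → (ℕ → Set ZFSet.{0}) → Prop
  | [], w => SOSat M A psi v w
  | k :: ks, w => ∀ X : ℕ → Set ZFSet.{0}, (∀ i, X i ⊆ M) → ¬ NFSat M A psi v ks (prepend k X w)

theorem NFSat_zero_cons {M A : Set ZFSet.{0}} {psi : SOForm} {v : ℕ → ZFSet.{0}} {ks : List ℕ}
    {w : ℕ → Set ZFSet.{0}} : NFSat M A psi v (0 :: ks) w ↔ ¬ NFSat M A psi v ks w :=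
  ⟨fun h => h (fun _ => ∅) fun _ => Set.empty_subset _, fun h _ _ => h⟩

theorem NFSat_succ_cons {M A : Set ZFSet.{0}} {psi : SOForm} {v : ℕ → ZFSet.{0}} {k : ℕ}
    {ks : List ℕ} {w : ℕ → Set ZFSet.{0}} : NFSat M A psi v ((k + 1) :: ks) w ↔
      ∀ P ⊆ M, NFSat M A psi v (k :: ks) (consVal P w) := by
  simp only [NFSat]
  refine ⟨fun h P hP X hX => ?_, fun h X hX => ?_⟩
  · have := h (Function.update X k P) fun i => by
      rcases eq_or_ne i k with rfl | hi
      · simpa using hP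
      · simpa [hi] using hX i
    rwa [prepend_succ, Function.update_self, prepend_congr (Y := X)
      fun i hi => Function.update_of_ne hi.ne _ _] at this
  · rw [prepend_succ]
    exact h (X k) (hX k) X hX

mutual

theorem IsPiForm.normal_form {n : ℕ} {phi : SOForm} : IsPiForm n phi →
    ∃ (ks : List ℕ) (psi : SOForm), ks.length = n ∧ psi.FO ∧
      ∀ M A v w, SOSat M A phi v w ↔ NFSat M A psi v ks w
  | .fo h => ⟨[], phi, rfl, h, fun _ _ _ _ => Iff.rfl⟩
  | .up h => by
    obtain ⟨ks, psi, h1, h2, h3⟩ := h.normal_form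
    exact ⟨0 :: ks, psi, by simp [h1], h2, fun M A v w => (h3 M A v w).trans
      NFSat_zero_cons.symm⟩
  | .all h => by
    obtain ⟨ks, psi, h1, h2, h3⟩ := h.normal_form
    match ks, h1 with
    | k :: ks, h1 =>
      exact ⟨(k + 1) :: ks, psi, h1, h2, fun M A v w =>
        (forall₂_congr fun P _ => h3 M A v _).trans NFSat_succ_cons.symm⟩

theorem IsSigmaForm.normal_form {n : ℕ} {phi : SOForm} : IsSigmaForm n phi →
    ∃ (ks : List ℕ) (psi : SOForm), ks.length = n ∧ psi.FO ∧
      ∀ M A v w, SOSat M A phi v w ↔ ¬ NFSat M A psi v ks w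
  | .fo h => ⟨[], .not phi, rfl, h, fun _ _ _ _ => not_not.symm⟩
  | .up h => by
    obtain ⟨ks, psi, h1, h2, h3⟩ := h.normal_form
    exact ⟨0 :: ks, psi, by simp [h1], h2, fun M A v w => by
      rw [NFSat_zero_cons, not_not, h3]⟩
  | .ex h => by
    obtain ⟨ks, psi, h1, h2, h3⟩ := h.normal_form
    match ks, h1 with
    | k :: ks, h1 =>
      exact ⟨(k + 1) :: ks, psi, h1, h2, fun M A v w => not_congr <|
        (forall₂_congr fun P _ => (not_congr (h3 M A v _)).trans not_not).trans
          NFSat_succ_cons.symm⟩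

end

end NormalForm

section Games

open Order ZFSet

/-- Code of the structure `(u, X₁ ∩ u, …, X_k ∩ u)`. -/
noncomputable def tup (u : ZFSet.{0}) : List (Set ZFSet.{0}) → ZFSet.{0}
  | [] => u
  | X :: l => pair (ZFSet.sep (· ∈ X) u) (tup u l)

theorem tup_inj {u u' : ZFSet.{0}} : ∀ {l l' : List (Set ZFSet.{0})}, l.length = l'.length →
    tup u l = tup u' l' → u = u' ∧
      l.map (· ∩ {x | x ∈ u}) = l'.map (· ∩ {x | x ∈ u})
  | [], [], _, h => ⟨h, rfl⟩
  | X :: l, X' :: l', hl, h => by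
    obtain ⟨h1, h2⟩ := pair_inj.1 h
    obtain ⟨rfl, h4⟩ := tup_inj (Nat.succ.inj hl) h2
    refine ⟨rfl, ?_⟩
    rw [List.map_cons, List.map_cons, h4]
    congr 1
    ext x
    have : x ∈ ZFSet.sep (· ∈ X) u ↔ x ∈ ZFSet.sep (· ∈ X') u := by rw [h1]
    rw [ZFSet.mem_sep, ZFSet.mem_sep] at this
    exact and_comm.trans (this.trans and_comm)

theorem tup_mem_Vrank {g : Ordinal.{0}} (hg : IsSuccLimit g) {u : ZFSet.{0}} (hu : u ∈ Vrank g) :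
    ∀ l, tup u l ∈ Vrank g
  | [] => hu
  | _ :: l => (pair_mem_Vrank hg).2
    ⟨lt_of_le_of_lt (rank_mono fun _ hx => (ZFSet.mem_sep.1 hx).1) hu, tup_mem_Vrank hg hu l⟩

theorem FODef.eq_tup (js : List ℕ) : ∀ i j, FODef fun _ _ v w => v i = tup (v j) (js.map w) := by
  induction js with
  | nil => exact FODef.eq
  | cons s js ih =>
    intro i j
    refine ((((FODef.eq_pair (i + 2) 1 0).and (ih 0 (j + 2))).and
      ((FODef.mem 0 2).iff ((FODef.mem 0 (j + 3)).and (FODef.app s 0))).fall).ex.ex).congr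
      fun g hg A v w hv => ?_
    constructor
    · rintro ⟨a, ha, b, -, ⟨h1, h2⟩, h3⟩
      change v i = pair a b at h1
      change b = tup (v j) (js.map w) at h2
      have h4 : a = ZFSet.sep (· ∈ w s) (v j) := by
        ext z
        rw [ZFSet.mem_sep]
        exact ⟨fun hz => (h3 z (Vrank_trans hz ha)).1 hz,
          fun hz => (h3 z (Vrank_trans hz.1 (hv j))).2 hz⟩
      rw [h1, h2, h4]
      rfl
    · intro h
      refine ⟨ZFSet.sep (· ∈ w s) (v j),
        lt_of_le_of_lt (rank_mono fun _ hx => (ZFSet.mem_sep.1 hx).1) (hv j),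
        tup (v j) (js.map w), tup_mem_Vrank hg (hv j) _, ⟨h, rfl⟩, fun z _ => ZFSet.mem_sep⟩

theorem FODef.tup_inA (j : ℕ) (js : List ℕ) : FODef fun _ A v w => tup (v j) (js.map w) ∈ A :=
  ((FODef.eq_tup js 0 (j + 1)).and (FODef.inA 0)).ex.congr fun g hg A v w hv => by
    refine ⟨?_, fun h => ⟨_, tup_mem_Vrank hg (hv j) _, rfl, h⟩⟩
    rintro ⟨x, -, h1, h2⟩
    change x = tup (v j) (js.map w) at h1
    exact h1 ▸ h2

/-- `F` is (the code of) a total relation on `V_γ`. -/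
def TotalOn (g : Ordinal.{0}) (F : Set ZFSet.{0}) : Prop :=
  ∀ x ∈ Vrank g, ∃ y ∈ Vrank g, pair x y ∈ F

/-- The nonempty set `u` is closed under the relation coded by `F`. -/
def RelClosed (u : ZFSet.{0}) (F : Set ZFSet.{0}) : Prop :=
  (∃ x, x ∈ u) ∧ ∀ x ∈ u, ∃ y ∈ u, pair x y ∈ F

theorem FODef.totalOn (s : ℕ) : FODef fun g _ _ w => TotalOn g (w s) :=
  (FODef.pair_app s 1 0).ex.fall

theorem FODef.relClosed (j s : ℕ) : FODef fun _ _ v w => RelClosed (v j) (w s) :=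
  ((FODef.mem 0 (j + 1)).ex.and
    ((FODef.mem 0 (j + 1)).imp ((FODef.mem 0 (j + 2)).and (FODef.pair_app s 1 0)).ex).fall).congr
    fun g _ A v w hv => by
      constructor
      · rintro ⟨⟨x, -, hx⟩, h⟩
        refine ⟨⟨x, hx⟩, fun x hx => ?_⟩
        obtain ⟨y, -, hy⟩ := h x (Vrank_trans hx (hv j)) hx
        exact ⟨y, hy⟩
      · rintro ⟨⟨x, hx⟩, h⟩
        refine ⟨⟨x, Vrank_trans hx (hv j), hx⟩, fun x _ hx => ?_⟩
        obtain ⟨y, hy, hy'⟩ := h x hx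
        exact ⟨y, Vrank_trans hy (hv j), hy, hy'⟩

theorem Inacc.relClosed_of_closedUnder {g : Ordinal.{0}} (hg : Inacc g) {F : Set ZFSet.{0}}
    (hF : TotalOn g F) : ∃ f : Ordinal.{0} → Ordinal.{0}, (∀ b < g, f b < g) ∧
      ∀ a, a ≤ g → ClosedUnder a f → RelClosed (vonNeumann a) F := by
  choose! r hr hr' using hF
  have hbd : ∀ b < g, ∃ d < g, ∀ x ∈ vonNeumann (succ b), (r x).rank < d := fun b hb =>
    hg.bound (vonNeumann_mem_Vrank.2 (hg.1.succ_lt hb))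
      fun x hx => hr x ((mem_vonNeumann.1 hx).trans (hg.1.succ_lt hb))
  choose! f hf hf' using hbd
  refine ⟨f, hf, fun a ha hc => ⟨⟨∅, ?_⟩, fun x hx => ?_⟩⟩
  · rw [mem_vonNeumann, rank_empty]
    exact hc.1
  · rw [mem_vonNeumann] at hx
    refine ⟨r x, ?_, hr' x (hx.trans_le ha)⟩
    rw [mem_vonNeumann]
    exact (hf' _ (hx.trans_le ha) x (mem_vonNeumann.2 (lt_succ _))).trans (hc.2 _ hx)

/-- A total relation on `V_γ` whose closure points are those of `f`. -/
def relOf (g : Ordinal.{0}) (f : Ordinal.{0} → Ordinal.{0}) : Set ZFSet.{0} :=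
  {z | ∃ x ∈ Vrank g, ∃ y ∈ Vrank g, z = pair x y ∧ f x.rank ≤ y.rank}

theorem relOf_subset {g : Ordinal.{0}} (hg : IsSuccLimit g) (f : Ordinal.{0} → Ordinal.{0}) :
    relOf g f ⊆ Vrank g := by
  rintro _ ⟨x, hx, y, hy, rfl, -⟩
  exact (pair_mem_Vrank hg).2 ⟨hx, hy⟩

theorem totalOn_relOf {g : Ordinal.{0}} {f : Ordinal.{0} → Ordinal.{0}} (hf : ∀ b < g, f b < g) :
    TotalOn g (relOf g f) := fun x hx =>
  ⟨vonNeumann (f x.rank), vonNeumann_mem_Vrank.2 (hf _ hx), x, hx, _,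
    vonNeumann_mem_Vrank.2 (hf _ hx), rfl, by rw [rank_vonNeumann]⟩

theorem closedUnder_of_relClosed {g a : Ordinal.{0}} {f : Ordinal.{0} → Ordinal.{0}}
    (h : RelClosed (vonNeumann a) (relOf g f)) : ClosedUnder a f := by
  obtain ⟨⟨x, hx⟩, h⟩ := h
  refine ⟨(zero_le (a := x.rank)).trans_lt (mem_vonNeumann.1 hx), fun b hb => ?_⟩
  obtain ⟨y, hy, x', -, y', -, he, hle⟩ := h (vonNeumann b) (by simpa [mem_vonNeumann] using hb)
  obtain ⟨rfl, rfl⟩ := pair_inj.1 he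
  rw [rank_vonNeumann] at hle
  exact hle.trans_lt (mem_vonNeumann.1 hy)

/-- The set of `u ∈ V_γ` with `(u, l ∩ u)` coded in `P` is stationary. -/
def Stat (g : Ordinal.{0}) (P : Set ZFSet.{0}) (l : List (Set ZFSet.{0})) : Prop :=
  ∀ F ⊆ Vrank g, TotalOn g F → ∃ u ∈ Vrank g, RelClosed u F ∧ tup u l ∈ P

/-- Universal `Π¹ₙ` properties (for `n ≥ 1`), with matrix given by a set of codes. -/
def Gm (g : Ordinal.{0}) (P : Set ZFSet.{0}) : ℕ → List (Set ZFSet.{0}) → Prop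
  | 0, l => ¬ Stat g P l
  | n + 1, l => ∀ X ⊆ Vrank g, ¬ Gm g P n (X :: l)

/-- Universal `Π¹ₙ` property (for `n ≥ 1`), simultaneously for all parameters `D ⊆ V_γ`. -/
def GmAll (n : ℕ) (g : Ordinal.{0}) (P : Set ZFSet.{0}) : Prop :=
  ∀ D ⊆ Vrank g, Gm g P n [D]

theorem Gm_inter {g : Ordinal.{0}} (hg : IsSuccLimit g) (P : Set ZFSet.{0}) :
    ∀ n l, Gm g (P ∩ Vrank g) n l ↔ Gm g P n l
  | 0, _ => not_congr <| forall₃_congr fun _ _ _ => exists_congr fun _ =>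
      and_congr_right fun hu => and_congr_right fun _ => and_iff_left (tup_mem_Vrank hg hu _)
  | n + 1, _ => forall₂_congr fun _ _ => not_congr (Gm_inter hg P n _)

theorem map_succ_consVal (js : List ℕ) (X : Set ZFSet.{0}) (w : ℕ → Set ZFSet.{0}) :
    (js.map Nat.succ).map (consVal X w) = js.map w := by
  rw [List.map_map]
  rfl

theorem PiDef.stat (js : List ℕ) : PiDef 1 fun g A _ w => Stat g A (js.map w) := by
  have h : FODef fun g A v w => ∃ u ∈ Vrank g, RelClosed (consVal u v 0) (w 0) ∧
      tup (consVal u v 0) ((js.map Nat.succ).map w) ∈ A :=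
    ((FODef.relClosed 0 0).and (FODef.tup_inA 0 (js.map Nat.succ))).ex
  refine (PiDef.all (PiDef.ofFO ((FODef.totalOn 0).imp h) 1)).congr fun g _ A v w _ => ?_
  simp only [map_succ_consVal]
  rfl

theorem PiDef.gm : ∀ (n : ℕ) (js : List ℕ),
    PiDef (n + 1) fun g A _ w => Gm g A (n + 1) (js.map w)
  | 0, js => (PiDef.all (PiDef.stat (0 :: js.map Nat.succ))).congr fun g _ A v w _ => by
      simp only [List.map_cons, map_succ_consVal]
      exact forall₂_congr fun _ _ => not_not.symm
  | n + 1, js => (PiDef.all (PiDef.neg (PiDef.gm n (0 :: js.map Nat.succ)))).congr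
      fun g _ A v w _ => by
        simp only [List.map_cons, map_succ_consVal]
        rfl

theorem PiDef.gmAll (n : ℕ) : PiDef (n + 1) fun g A _ _ => GmAll (n + 1) g A :=
  PiDef.all (PiDef.gm n [0])

/-- Decode a sequence of sets. -/
def dec (Z : Set ZFSet.{0}) (i : ℕ) : Set ZFSet.{0} := {x | pair (vonNeumann i) x ∈ Z}

/-- The least rank of an element of `D`. -/
noncomputable def leastRank (D : Set ZFSet.{0}) : Ordinal.{0} := sInf (rank '' D)

theorem leastRank_inter {D : Set ZFSet.{0}} {a : Ordinal.{0}} (h : leastRank D < a) :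
    leastRank (D ∩ Vrank a) = leastRank D := by
  rcases D.eq_empty_or_nonempty with rfl | hD
  · rw [Set.empty_inter]
  · obtain ⟨x, hx, he⟩ := csInf_mem (hD.image rank)
    have hxa : x ∈ Vrank a := lt_of_eq_of_lt he h
    have hmem : x.rank ∈ rank '' (D ∩ Vrank a) := ⟨x, ⟨hx, hxa⟩, rfl⟩
    refine le_antisymm ((csInf_le' hmem).trans he.le) (le_csInf ⟨_, hmem⟩ ?_)
    rintro _ ⟨y, hy, rfl⟩
    exact csInf_le' (Set.mem_image_of_mem _ hy.1)

theorem leastRank_lt {D : Set ZFSet.{0}} {g : Ordinal.{0}} (hg : 0 < g) (hD : D ⊆ Vrank g) :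
    leastRank D < g := by
  rcases D.eq_empty_or_nonempty with rfl | ⟨x, hx⟩
  · simpa [leastRank] using hg
  · exact lt_of_le_of_lt (csInf_le' ⟨x, hx, rfl⟩) (hD hx)

/-- The valuation coded by a list of sets, for a given list of lengths of blocks. -/
def decVal : List ℕ → List (Set ZFSet.{0}) → ℕ → Set ZFSet.{0}
  | k :: rk, X :: l => prepend k (dec X) (decVal rk l)
  | _, _ => fun _ => ∅

theorem natCast_lt_of_isSuccLimit {g : Ordinal.{0}} (hg : IsSuccLimit g) (i : ℕ) :
    (i : Ordinal.{0}) < g := by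
  induction i with
  | zero => exact pos_of_isSuccLimit hg
  | succ i ih => simpa using hg.succ_lt ih

theorem dec_inter {a : Ordinal.{0}} (ha : IsSuccLimit a) (Z : Set ZFSet.{0}) (i : ℕ) :
    dec (Z ∩ Vrank a) i ∩ Vrank a = dec Z i ∩ Vrank a := by
  ext x
  refine and_congr_left fun hx => and_iff_left ?_
  exact (pair_mem_Vrank ha).2 ⟨vonNeumann_mem_Vrank.2 (natCast_lt_of_isSuccLimit ha i), hx⟩

theorem decVal_inter {a : Ordinal.{0}} (ha : IsSuccLimit a) : ∀ rk l i,
    decVal rk (l.map (· ∩ Vrank a)) i ∩ Vrank a = decVal rk l i ∩ Vrank a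
  | [], _, _ => rfl
  | _ :: _, [], _ => rfl
  | k :: rk, X :: l, i => by
    simp only [List.map_cons, decVal, prepend]
    split_ifs
    · exact dec_inter ha X i
    · exact decVal_inter ha rk l _

theorem exists_dec {g : Ordinal.{0}} (hg : IsSuccLimit g) {X : ℕ → Set ZFSet.{0}}
    (hX : ∀ i, X i ⊆ Vrank g) : ∃ Z ⊆ Vrank g, dec Z = X := by
  refine ⟨{z | ∃ (i : ℕ) (x : ZFSet.{0}), x ∈ X i ∧ z = pair (vonNeumann i) x}, ?_, ?_⟩
  · rintro _ ⟨i, x, hx, rfl⟩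
    exact (pair_mem_Vrank hg).2
      ⟨vonNeumann_mem_Vrank.2 (natCast_lt_of_isSuccLimit hg i), hX i hx⟩
  · funext i
    ext x
    constructor
    · rintro ⟨j, y, hy, he⟩
      obtain ⟨h1, rfl⟩ := pair_inj.1 he
      rw [vonNeumann_inj, Nat.cast_inj] at h1
      exact h1 ▸ hy
    · exact fun hx => ⟨i, x, hx, rfl⟩

theorem dec_subset {g : Ordinal.{0}} (hg : IsSuccLimit g) {Z : Set ZFSet.{0}} (hZ : Z ⊆ Vrank g)
    (i : ℕ) : dec Z i ⊆ Vrank g := fun _ hx => ((pair_mem_Vrank hg).1 (hZ hx)).2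

/-- The codes of the structures in which the `δ`-th matrix fails, where `δ` is given by the last
set of the structure. -/
def failCodes (n : ℕ) (ks : Ordinal.{0} → List ℕ) (psi : Ordinal.{0} → SOForm)
    (A : Ordinal.{0} → Set ZFSet.{0}) : Set ZFSet.{0} :=
  {z | ∃ (a : Ordinal.{0}) (l : List (Set ZFSet.{0})) (D : Set ZFSet.{0}), IsSuccLimit a ∧
    l.length = n ∧ z = tup (vonNeumann a) (l ++ [D]) ∧
    ¬ SOSat (Vrank a) (A (leastRank (D ∩ Vrank a)) ∩ Vrank a) (psi (leastRank (D ∩ Vrank a)))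
      (fun _ => ∅) fun i => decVal (ks (leastRank (D ∩ Vrank a))).reverse l i ∩ Vrank a}

theorem tup_mem_failCodes {n : ℕ} {ks : Ordinal.{0} → List ℕ} {psi : Ordinal.{0} → SOForm}
    {A : Ordinal.{0} → Set ZFSet.{0}} {a : Ordinal.{0}} {l : List (Set ZFSet.{0})}
    {D : Set ZFSet.{0}} (ha : IsSuccLimit a) (hl : l.length = n) (hD : leastRank D < a) :
    tup (vonNeumann a) (l ++ [D]) ∈ failCodes n ks psi A ↔
      ¬ SOSat (Vrank a) (A (leastRank D) ∩ Vrank a) (psi (leastRank D))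
        (fun _ => ∅) fun i => decVal (ks (leastRank D)).reverse l i ∩ Vrank a := by
  constructor
  · rintro ⟨a', l', D', -, hl', he, H⟩
    obtain ⟨h1, h2⟩ := tup_inj (by simp [hl, hl']) he
    obtain rfl := vonNeumann_inj.1 h1
    rw [coe_vonNeumann, List.map_append, List.map_append] at h2
    obtain ⟨h3, h4⟩ := List.append_inj h2 (by simp [hl, hl'])
    have h5 : D ∩ Vrank a = D' ∩ Vrank a := by simpa using h4
    rw [← h5, leastRank_inter hD] at H
    have h6 : ∀ i, decVal (ks (leastRank D)).reverse l' i ∩ Vrank a =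
        decVal (ks (leastRank D)).reverse l i ∩ Vrank a := fun i => by
      rw [← decVal_inter ha _ l, h3, decVal_inter ha]
    simpa only [h6] using H
  · intro H
    refine ⟨a, l, D, ha, hl, rfl, ?_⟩
    rwa [leastRank_inter hD]

theorem Inacc.stat_failCodes {g : Ordinal.{0}} (hg : Inacc g) {n : ℕ}
    {ks : Ordinal.{0} → List ℕ} {psi : Ordinal.{0} → SOForm} (hpsi : ∀ d, (psi d).FO)
    {A : Ordinal.{0} → Set ZFSet.{0}} {l : List (Set ZFSet.{0})} {D : Set ZFSet.{0}}
    (hl : l.length = n) (hD : D ⊆ Vrank g) :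
    Stat g (failCodes n ks psi A) (l ++ [D]) ↔
      ¬ SOSat (Vrank g) (A (leastRank D) ∩ Vrank g) (psi (leastRank D))
        (fun _ => ∅) (decVal (ks (leastRank D)).reverse l) := by
  obtain ⟨f, hf, hr⟩ := hg.reflect_fo (hpsi (leastRank D)) (A (leastRank D) ∩ Vrank g)
    (decVal (ks (leastRank D)).reverse l)
  have hd : leastRank D < g := leastRank_lt (pos_of_isSuccLimit hg.1) hD
  let f' : Ordinal.{0} → Ordinal.{0} := fun b => max (f b) (max (succ b) (succ (leastRank D)))
  have hf' : ∀ b < g, f' b < g := fun b hb =>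
    max_lt (hf b hb) (max_lt (hg.1.succ_lt hb) (hg.1.succ_lt hd))
  have key : ∀ a < g, ClosedUnder a f' →
      (tup (vonNeumann a) (l ++ [D]) ∈ failCodes n ks psi A ↔
        ¬ SOSat (Vrank g) (A (leastRank D) ∩ Vrank g) (psi (leastRank D))
          (fun _ => ∅) (decVal (ks (leastRank D)).reverse l)) := by
    intro a ha hc
    have hlim : IsSuccLimit a := ClosedUnder.isSuccLimit <| hc.mono fun _ _ =>
      (le_max_left _ _).trans (le_max_right _ _)
    have hda : leastRank D < a := (lt_succ _).trans_le <|
      ((le_max_right _ _).trans (le_max_right _ _)).trans (hc.2 0 hc.1).le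
    rw [tup_mem_failCodes hlim hl hda, ← hr a ha (hc.mono fun _ _ => le_max_left _ _)
      (succ 0) (hlim.succ_lt hc.1) _ fun _ => empty_mem_Vrank (lt_succ 0), Vrank_inter ha.le]
  constructor
  · intro H
    obtain ⟨u, hu, hc, hP⟩ := H (relOf g f') (relOf_subset hg.1 f') (totalOn_relOf hf')
    obtain ⟨a, l', D', -, hl', he, -⟩ := id hP
    obtain rfl := (tup_inj (by simp [hl, hl']) he).1
    exact (key a (vonNeumann_mem_Vrank.1 hu) (closedUnder_of_relClosed hc)).1 hP
  · intro H F _ hF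
    obtain ⟨h, hh, hh'⟩ := hg.relClosed_of_closedUnder hF
    obtain ⟨a, ha, hc⟩ := hg.exists_closedUnder (f := fun b => max (f' b) (h b))
      fun b hb => max_lt (hf' b hb) (hh b hb)
    exact ⟨vonNeumann a, vonNeumann_mem_Vrank.2 ha,
      hh' a ha.le (hc.mono fun _ _ => le_max_right _ _),
      (key a ha (hc.mono fun _ _ => le_max_left _ _)).2 H⟩

theorem Inacc.gm_failCodes {g : Ordinal.{0}} (hg : Inacc g) {n : ℕ}
    {ks : Ordinal.{0} → List ℕ} (hks : ∀ d, (ks d).length = n)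
    {psi : Ordinal.{0} → SOForm} (hpsi : ∀ d, (psi d).FO)
    {A : Ordinal.{0} → Set ZFSet.{0}} {D : Set ZFSet.{0}} (hD : D ⊆ Vrank g) :
    ∀ (ks' rk : List ℕ) (l : List (Set ZFSet.{0})), l.length = rk.length →
      ks'.reverse ++ rk = (ks (leastRank D)).reverse →
      (Gm g (failCodes n ks psi A) ks'.length (l ++ [D]) ↔
        NFSat (Vrank g) (A (leastRank D) ∩ Vrank g) (psi (leastRank D)) (fun _ => ∅) ks'
          (decVal rk l)) := by
  intro ks'
  induction ks' with
  | nil =>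
    intro rk l hl he
    obtain rfl : rk = (ks (leastRank D)).reverse := he
    exact (not_congr (hg.stat_failCodes hpsi (by simp [hl, hks]) hD)).trans not_not
  | cons k ks' ih =>
    intro rk l hl he
    have ih' := fun X => ih (k :: rk) (X :: l) (by simp [hl]) (by simpa using he)
    constructor
    · intro H X hX
      obtain ⟨Z, hZ, rfl⟩ := exists_dec hg.1 hX
      exact fun h => H Z hZ ((ih' Z).2 h)
    · exact fun H Z hZ h => H (dec Z) (dec_subset hg.1 hZ) ((ih' Z).1 h)

/-- Any family of `Π¹ₙ` properties can be uniformly replaced by a universal one. -/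
theorem exists_gmAll_iff {n : ℕ} {phi : Ordinal.{0} → SOForm} (hphi : ∀ d, IsPiForm n (phi d))
    (A : Ordinal.{0} → Set ZFSet.{0}) : ∃ P : Set ZFSet.{0}, ∀ g, Inacc g →
      (GmAll n g (P ∩ Vrank g) ↔ ∀ d < g, SOSatS (Vrank g) (A d ∩ Vrank g) (phi d)) := by
  choose ks psi hks hpsi hsat using fun d => (hphi d).normal_form
  refine ⟨failCodes n ks psi A, fun g hg => ?_⟩
  have key : ∀ D ⊆ Vrank g, (Gm g (failCodes n ks psi A ∩ Vrank g) n [D] ↔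
      SOSatS (Vrank g) (A (leastRank D) ∩ Vrank g) (phi (leastRank D))) := by
    intro D hD
    have h := hg.gm_failCodes hks hpsi (A := A) hD (ks (leastRank D)) [] [] rfl (by simp)
    rw [hks] at h
    rw [Gm_inter hg.1, SOSatS, hsat]
    exact h
  constructor
  · intro H d hd
    have hD : ({vonNeumann d} : Set ZFSet.{0}) ⊆ Vrank g :=
      Set.singleton_subset_iff.2 (vonNeumann_mem_Vrank.2 hd)
    have := (key _ hD).1 (H _ hD)
    rwa [show leastRank {vonNeumann d} = d by simp [leastRank]] at this
  · exact fun H D hD => (key D hD).2 (H _ (leastRank_lt (pos_of_isSuccLimit hg.1) hD))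

end Games

section Reflection

open Order ZFSet

theorem PiIndesc.mono {n : ℕ} {X Y : Set Ordinal.{0}} {g : Ordinal.{0}} (h : PiIndesc n X g)
    (hXY : X ⊆ Y) (hY : Y ⊆ Set.Iio g) : PiIndesc n Y g :=
  ⟨hY, fun A hA phi hphi hs => (h.2 A hA phi hphi hs).imp fun _ hx => ⟨hXY hx.1, hx.2⟩⟩

theorem PiIndesc.piIndCard {n : ℕ} {X : Set Ordinal.{0}} {g : Ordinal.{0}}
    (h : PiIndesc n X g) : PiIndCard n g := h.mono h.1 subset_rfl

theorem PiIndesc.reflect {n : ℕ} {X : Set Ordinal.{0}} {g : Ordinal.{0}} (hX : PiIndesc n X g)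
    (hg : IsSuccLimit g) {R : Ordinal.{0} → Set ZFSet.{0} → Prop}
    (hR : PiDef n fun g A _ _ => R g A) {A : Set ZFSet.{0}} (hA : A ⊆ Vrank g) (h : R g A) :
    ∃ a ∈ X, IsSuccLimit a ∧ R a (A ∩ Vrank a) := by
  obtain ⟨phi, hphi, hs⟩ := hR.exists_sentence
  obtain ⟨a, ha, h⟩ := hX.2 A hA phi hphi ((hs g A).2 ⟨hg, h⟩)
  exact ⟨a, ha, (hs _ _).1 h⟩

theorem PiIndesc.exists_gt {n : ℕ} {X : Set Ordinal.{0}} {g d : Ordinal.{0}}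
    (hX : PiIndesc n X g) (hd : d < g) : ∃ a ∈ X, d < a := by
  obtain ⟨a, ha, h⟩ := (hX.of_le n.zero_le).2 {vonNeumann d}
    (Set.singleton_subset_iff.2 (vonNeumann_mem_Vrank.2 hd)) (.not (.fall (.not (.inA 0))))
    (.fo trivial) fun h => h _ (vonNeumann_mem_Vrank.2 hd) rfl
  refine ⟨a, ha, ?_⟩
  by_contra hlt
  refine h fun x hx hxA => hlt ?_
  obtain rfl : x = vonNeumann d := hxA.1
  exact vonNeumann_mem_Vrank.1 hx

theorem PiIndCard.isSuccLimit {n : ℕ} {g : Ordinal.{0}} (h : PiIndCard n g) : IsSuccLimit g := by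
  rw [Ordinal.isSuccLimit_iff]
  refine ⟨?_, isSuccPrelimit_of_succ_lt fun d hd => ?_⟩
  · rintro rfl
    obtain ⟨a, ha, -⟩ := (h.of_le n.zero_le).2 ∅ (Set.empty_subset _) (.not (.mem 0 0))
      (.fo trivial) (ZFSet.notMem_empty ∅)
    exact not_lt_zero (Set.mem_Iio.1 ha)
  · obtain ⟨a, ha, hda⟩ := h.exists_gt hd
    exact (succ_le_of_lt hda).trans_lt ha

theorem PiIndCard.inacc {n : ℕ} {g : Ordinal.{0}} (h : PiIndCard n g) : Inacc g := by
  have hg := h.isSuccLimit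
  have h0 : PiIndesc 0 (Set.Iio g) g := h.of_le n.zero_le
  refine ⟨hg, ?_, fun F hF s hs => ?_⟩
  · obtain ⟨a, ha, hlim, -⟩ := h0.reflect hg (R := fun _ _ => True)
      ((PiDef.fo ((FODef.mem 0 0).imp (FODef.mem 0 0))).congr fun _ _ _ _ _ _ =>
        iff_true_intro id) (Set.empty_subset _) trivial
    exact (Ordinal.omega0_le_of_isSuccLimit hlim).trans_lt ha
  · let s' := ZFSet.sep (fun x => ∃ y ∈ Vrank g, pair x y ∈ F) s
    have hs' : s' ∈ Vrank g :=
      lt_of_le_of_lt (rank_mono fun _ hx => (ZFSet.mem_sep.1 hx).1) hs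
    by_cases hne : ∃ x, x ∈ s'
    · have hdef : FODef fun g A _ _ => ∃ t ∈ Vrank g,
          (∃ x ∈ Vrank g, ∃ y ∈ Vrank g, pair t (pair x y) ∈ A) ∧
            ∀ x ∈ Vrank g, x ∈ t → ∃ y ∈ Vrank g, pair t (pair x y) ∈ A := by
        have hp : FODef fun g A v w => pair (v 2) (pair (v 1) (v 0)) ∈ A :=
          ((FODef.eq_pair 0 2 1).and (FODef.pair_inA 3 0)).ex.congr fun g hg A v w hv => by
            refine ⟨?_, fun h => ⟨_, (pair_mem_Vrank hg).2 ⟨hv 1, hv 0⟩, rfl, h⟩⟩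
            rintro ⟨x, -, h1, h2⟩
            change x = pair (v 1) (v 0) at h1
            exact h1 ▸ h2
        exact (hp.ex.ex.and ((FODef.mem 0 1).imp hp.ex).fall).ex
      obtain ⟨a, ha, hlim, t, ht, ⟨x, -, y, -, ⟨x₁, y₁, -, he⟩, -⟩, H⟩ := h0.reflect hg
        (PiDef.fo hdef) (A := {z | ∃ x y, pair x y ∈ F ∧ z = pair s' (pair x y)})
        (by
          rintro _ ⟨x, y, hxy, rfl⟩
          exact (pair_mem_Vrank hg).2 ⟨hs', hF hxy⟩)
        (by
          obtain ⟨x, hx⟩ := hne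
          obtain ⟨y, hy, hxy⟩ := (ZFSet.mem_sep.1 hx).2
          refine ⟨s', hs', ⟨x, Vrank_trans hx hs', y, hy, x, y, hxy, rfl⟩, fun x hx hxs => ?_⟩
          obtain ⟨y, hy, hxy⟩ := (ZFSet.mem_sep.1 hxs).2
          exact ⟨y, hy, x, y, hxy, rfl⟩)
      obtain rfl := (pair_inj.1 he).1
      refine ⟨vonNeumann a, vonNeumann_mem_Vrank.2 ha, fun x hx hxs hy => ?_⟩
      have hxs' : x ∈ s' := ZFSet.mem_sep.2 ⟨hxs, hy⟩
      obtain ⟨y, hy, ⟨x', y', hxy, he⟩, -⟩ := H x (Vrank_trans hxs' ht) hxs'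
      obtain ⟨rfl, rfl⟩ := pair_inj.1 (pair_inj.1 he).2
      exact ⟨y, Vrank_mono (le_of_lt ha) hy, mem_vonNeumann.2 hy, hxy⟩
    · exact ⟨∅, empty_mem_Vrank (pos_of_isSuccLimit hg), fun x _ hxs hy =>
        (hne ⟨x, ZFSet.mem_sep.2 ⟨hxs, hy⟩⟩).elim⟩

/-- The set of `γ` satisfying every sentence of index below `γ` of a family of `Π¹ₙ` sentences
true in `V_κ` is large, for `n ≥ 1`. -/
theorem PiIndesc.exists_reflect_family {n : ℕ} {Y : Set Ordinal.{0}} {g : Ordinal.{0}}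
    (hY : PiIndesc (n + 1) Y g) {phi : Ordinal.{0} → SOForm}
    (hphi : ∀ d, IsPiForm (n + 1) (phi d)) {A : Ordinal.{0} → Set ZFSet.{0}}
    (h : ∀ d < g, SOSatS (Vrank g) (A d ∩ Vrank g) (phi d)) :
    ∃ a ∈ Y, Inacc a ∧ ∀ d < a, SOSatS (Vrank a) (A d ∩ Vrank a) (phi d) := by
  have hg : Inacc g := hY.piIndCard.inacc
  obtain ⟨P, hP⟩ := exists_gmAll_iff hphi A
  obtain ⟨a, ha, -, hi, hG⟩ := hY.reflect hg.1 (PiDef.gmAll n).and_inacc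
    (A := P ∩ Vrank g) Set.inter_subset_right ⟨hg, (hP g hg).2 h⟩
  rw [Vrank_inter (hY.1 ha).le] at hG
  exact ⟨a, ha, hi, (hP a hi).1 hG⟩

theorem PiIndesc.reflect_family {n : ℕ} {Y : Set Ordinal.{0}} {g : Ordinal.{0}}
    (hY : PiIndesc (n + 1) Y g) {phi : Ordinal.{0} → SOForm}
    (hphi : ∀ d, IsPiForm (n + 1) (phi d)) {A : Ordinal.{0} → Set ZFSet.{0}}
    (h : ∀ d < g, SOSatS (Vrank g) (A d ∩ Vrank g) (phi d)) :
    PiIndesc (n + 1)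
      {a ∈ Y | Inacc a ∧ ∀ d < a, SOSatS (Vrank a) (A d ∩ Vrank a) (phi d)} g := by
  refine ⟨fun a ha => hY.1 ha.1, fun B hB psi hpsi hs => ?_⟩
  obtain ⟨a, ha, hi, H⟩ := hY.exists_reflect_family
    (phi := fun d => if d = 0 then psi else phi (d - 1))
    (A := fun d => if d = 0 then B else A (d - 1))
    (fun d => by
      split_ifs
      exacts [hpsi, hphi _])
    (fun d hd => by
      split_ifs
      · rwa [Set.inter_eq_left.2 hB]
      · exact h _ ((Ordinal.sub_le_self d 1).trans_lt hd))
  refine ⟨a, ⟨ha, hi, fun d hd => ?_⟩, by simpa using H 0 (pos_of_isSuccLimit hi.1)⟩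
  have h1 : 1 + d < a := by
    rw [← Ordinal.one_add_of_omega0_le hi.2.1.le]
    exact add_lt_add_right hd 1
  simpa using H (1 + d) h1

theorem PiIndesc.reflect_sentence {n : ℕ} {Y : Set Ordinal.{0}} {g : Ordinal.{0}}
    (hY : PiIndesc (n + 1) Y g) {phi : SOForm} (hphi : IsPiForm (n + 1) phi) {A : Set ZFSet.{0}}
    (hA : A ⊆ Vrank g) (h : SOSatS (Vrank g) A phi) :
    PiIndesc (n + 1) {a ∈ Y | Inacc a ∧ SOSatS (Vrank a) (A ∩ Vrank a) phi} g :=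
  (hY.reflect_family (fun _ => hphi) (A := fun _ => A) fun _ _ => by
    rwa [Set.inter_eq_left.2 hA]).mono
    (fun _ ha => ⟨ha.1, ha.2.1, ha.2.2 0 (pos_of_isSuccLimit ha.2.1.1)⟩) fun _ ha => hY.1 ha.1

end Reflection

section Indescribability

open Order ZFSet

theorem FODef.mem_predSource (i : ℕ) : ∀ o, FODef fun _ A v w => v i ∈ predSource A w o
  | none => FODef.inA i
  | some s => FODef.app s i

/-- Second-order satisfaction in the structure `(u, X ∩ u)`, where `u` is a set in `V_γ`, is
first-order definable. -/
theorem FODef.sat_rel (chi : SOForm) : ∀ (r q : ℕ → ℕ) (c : ℕ) (o : Option ℕ),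
    FODef fun _ A v w => SOSat {x | x ∈ v c} (predSource A w o ∩ {x | x ∈ v c}) chi
      (fun i => v (r i)) fun i => {x | x ∈ v (q i)} := by
  induction chi with
  | mem i j => exact fun r q c o => FODef.mem _ _
  | app i j => exact fun r q c o => FODef.mem _ _
  | inA i => exact fun r q c o => (FODef.mem_predSource _ o).and (FODef.mem _ c)
  | not phi ih => exact fun r q c o => (ih r q c o).not
  | and phi psi ih1 ih2 => exact fun r q c o => (ih1 r q c o).and (ih2 r q c o)
  | fall phi ih =>
    intro r q c o
    refine ((FODef.mem 0 (c + 1)).imp (ih (fun i => Nat.casesOn i 0 fun j => r j + 1)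
      (fun i => q i + 1) (c + 1) o)).fall.congr fun g _ A v w hv => ?_
    simp only [consVal_comp]
    exact ⟨fun h x hx => h x (Vrank_trans hx (hv c)) hx, fun h x _ hx => h x hx⟩
  | sall phi ih =>
    intro r q c o
    refine (((FODef.mem 0 1).imp (FODef.mem 0 (c + 2))).fall.imp (ih (fun i => r i + 1)
      (fun i => Nat.casesOn i 0 fun j => q j + 1) (c + 1) o)).fall.congr fun g _ A v w hv => ?_
    have hcv : ∀ y, (fun i => {x | x ∈ consVal y v (Nat.casesOn i 0 fun j => q j + 1)}) =
        consVal {x | x ∈ y} fun i => {x | x ∈ v (q i)} := fun y => by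
      funext i
      cases i <;> rfl
    simp only [hcv]
    constructor
    · intro h P hP
      have he : {x | x ∈ ZFSet.sep (· ∈ P) (v c)} = P := by
        ext x
        exact ZFSet.mem_sep.trans (and_iff_right_of_imp fun hx => hP hx)
      have := h (ZFSet.sep (· ∈ P) (v c))
        (lt_of_le_of_lt (rank_mono fun _ hx => (ZFSet.mem_sep.1 hx).1) (hv c))
        fun x _ hx => (ZFSet.mem_sep.1 hx).1
      rwa [he] at this
    · exact fun h y hy hyc => h {x | x ∈ y} fun x hx => hyc x (Vrank_trans hx hy) hx

theorem FODef.exists_satS (chi : SOForm) (o : Option ℕ) : FODef fun g A _ w =>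
    ∃ u ∈ Vrank g, u ∈ A ∧ SOSatS {x | x ∈ u} (predSource A w o ∩ {x | x ∈ u}) chi := by
  refine ((FODef.mem 0 1).not.fall.and ((FODef.inA 1).and
    (FODef.sat_rel chi (fun _ => 0) (fun _ => 0) 1 o))).ex.ex.congr fun g hg A v w hv => ?_
  refine exists_congr fun u => and_congr_right fun hu => ?_
  have he : {x : ZFSet.{0} | x ∈ (∅ : ZFSet.{0})} = ∅ := by ext; simp
  constructor
  · rintro ⟨e, he', h1, h2, h3⟩
    have : e = ∅ := by
      rw [ZFSet.eq_empty]
      exact fun x hx => h1 x (Vrank_trans hx he') hx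
    subst this
    change SOSat _ _ chi (fun _ => ∅) (fun _ => {x : ZFSet.{0} | x ∈ (∅ : ZFSet.{0})}) at h3
    rw [he] at h3
    exact ⟨h2, h3⟩
  · rintro ⟨h2, h3⟩
    refine ⟨∅, empty_mem_Vrank (pos_of_isSuccLimit hg), fun x _ => ZFSet.notMem_empty x, h2, ?_⟩
    change SOSat _ _ chi (fun _ => ∅) (fun _ => {x : ZFSet.{0} | x ∈ (∅ : ZFSet.{0})})
    rw [he]
    exact h3

theorem image_vonNeumann_inter (C : Set Ordinal.{0}) (g : Ordinal.{0}) :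
    vonNeumann '' C ∩ Vrank g = vonNeumann '' (C ∩ Set.Iio g) := by
  ext x
  constructor
  · rintro ⟨⟨a, ha, rfl⟩, hx⟩
    exact ⟨a, ⟨ha, vonNeumann_mem_Vrank.1 hx⟩, rfl⟩
  · rintro ⟨a, ⟨ha, hg⟩, rfl⟩
    exact ⟨⟨a, ha, rfl⟩, vonNeumann_mem_Vrank.2 hg⟩

theorem image_vonNeumann_subset {C : Set Ordinal.{0}} {g : Ordinal.{0}} (hC : C ⊆ Set.Iio g) :
    vonNeumann '' C ⊆ Vrank g := by
  rintro _ ⟨a, ha, rfl⟩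
  exact vonNeumann_mem_Vrank.2 (hC ha)

/-- `Π¹₀`-indescribability amounts to stationarity. -/
theorem Inacc.piIndesc_zero_iff {g : Ordinal.{0}} (hg : Inacc g) {C : Set Ordinal.{0}}
    (hC : C ⊆ Set.Iio g) : PiIndesc 0 C g ↔
      ∀ F ⊆ Vrank g, TotalOn g F → ∃ a ∈ C, RelClosed (vonNeumann a) F := by
  constructor
  · intro h F hF hT
    obtain ⟨a, ha, hlim, H⟩ := h.reflect hg.1 (R := TotalOn)
      (PiDef.fo (FODef.pair_inA 1 0).ex.fall) hF hT
    refine ⟨a, ha, ⟨∅, ?_⟩, fun x hx => ?_⟩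
    · rw [mem_vonNeumann, rank_empty]
      exact pos_of_isSuccLimit hlim
    · obtain ⟨y, hy, hxy⟩ := H x (mem_vonNeumann.1 hx)
      exact ⟨y, mem_vonNeumann.2 hy, hxy.1⟩
  · refine fun h => ⟨hC, fun A hA phi hphi hs => ?_⟩
    cases hphi with
    | fo hphi =>
      obtain ⟨f, hf, hr⟩ := hg.reflect_fo hphi A fun _ => ∅
      have hf' : ∀ b < g, max (f b) (succ b) < g := fun b hb => max_lt (hf b hb) (hg.1.succ_lt hb)
      obtain ⟨a, ha, hc⟩ := h _ (relOf_subset hg.1 _) (totalOn_relOf hf')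
      have hc' := closedUnder_of_relClosed hc
      have hlim : IsSuccLimit a :=
        ClosedUnder.isSuccLimit (hc'.mono fun _ _ => le_max_right _ _)
      refine ⟨a, ha, ?_⟩
      have := (hr a (hC ha) (hc'.mono fun _ _ => le_max_left _ _) (succ 0)
        (hlim.succ_lt hc'.1) _ fun _ => empty_mem_Vrank (lt_succ 0)).2 hs
      simpa only [SOSatS, Set.empty_inter] using this

/-- `Π¹ₙ`-indescribability of subsets is a `Π¹ₙ₊₁` property. -/
theorem exists_piIndesc_form (n : ℕ) : ∃ theta, IsPiForm (n + 1) theta ∧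
    ∀ g, Inacc g → ∀ C ⊆ Set.Iio g,
      (SOSatS (Vrank g) (vonNeumann '' C) theta ↔ PiIndesc n C g) := by
  cases n with
  | zero =>
    obtain ⟨theta, h1, h2⟩ := PiDef.exists_sentence (R := fun g A => ∀ F ⊆ Vrank g,
      TotalOn g F → ∃ u ∈ Vrank g, u ∈ A ∧ RelClosed u F)
      (PiDef.all (PiDef.ofFO ((FODef.totalOn 0).imp
        ((FODef.inA 0).and (FODef.relClosed 0 0)).ex) 1))
    refine ⟨theta, h1, fun g hg C hC => ?_⟩
    rw [h2, and_iff_right hg.1, hg.piIndesc_zero_iff hC]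
    refine forall₃_congr fun F _ _ => ⟨?_, ?_⟩
    · rintro ⟨_, -, ⟨a, ha, rfl⟩, h⟩
      exact ⟨a, ha, h⟩
    · rintro ⟨a, ha, h⟩
      exact ⟨_, vonNeumann_mem_Vrank.2 (hC ha), ⟨a, ha, rfl⟩, h⟩
  | succ n =>
    obtain ⟨chi, hchi, hchi'⟩ := (PiDef.gmAll n).and_inacc.exists_sentence
    obtain ⟨theta, h1, h2⟩ := PiDef.exists_sentence (R := fun g A => ∀ P ⊆ Vrank g,
      ¬ GmAll (n + 1) g P ∨ ∃ u ∈ Vrank g, u ∈ A ∧ SOSatS {x | x ∈ u} (P ∩ {x | x ∈ u}) chi)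
      (PiDef.all ((PiDef.neg ((PiDef.gmAll n).ren id (some 0))).and_or_fo
        (FODef.exists_satS chi (some 0))).2)
    refine ⟨theta, h1, fun g hg C hC => ?_⟩
    rw [h2, and_iff_right hg.1]
    constructor
    · refine fun H => ⟨hC, fun A hA phi hphi hs => ?_⟩
      obtain ⟨P, hP⟩ := exists_gmAll_iff (fun _ => hphi) fun _ => A
      obtain h | ⟨_, -, ⟨a, ha, rfl⟩, hsat⟩ := H (P ∩ Vrank g) Set.inter_subset_right
      · refine (h ((hP g hg).2 fun _ _ => ?_)).elim
        rwa [Set.inter_eq_left.2 hA]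
      · rw [coe_vonNeumann, Vrank_inter (hC ha).le, hchi'] at hsat
        exact ⟨a, ha, (hP a hsat.2.1).1 hsat.2.2 0 (pos_of_isSuccLimit hsat.1)⟩
    · intro H P hP
      refine or_iff_not_imp_left.2 fun hG => ?_
      obtain ⟨a, ha, h⟩ := H.2 P hP chi hchi ((hchi' g P).2 ⟨hg.1, hg, not_not.1 hG⟩)
      refine ⟨_, vonNeumann_mem_Vrank.2 (hC ha), ⟨a, ha, rfl⟩, ?_⟩
      rwa [coe_vonNeumann]

theorem PiIndesc.reflect_piIndesc {n : ℕ} {Y C : Set Ordinal.{0}} {g : Ordinal.{0}}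
    (hY : PiIndesc (n + 1) Y g) (hC : PiIndesc n C g) :
    PiIndesc (n + 1) {a ∈ Y | PiIndesc n (C ∩ Set.Iio a) a} g := by
  obtain ⟨theta, h1, h2⟩ := exists_piIndesc_form n
  refine (hY.reflect_sentence h1 (image_vonNeumann_subset hC.1)
    ((h2 g hY.piIndCard.inacc C hC.1).2 hC)).mono (fun a ha => ⟨ha.1, ?_⟩) fun _ ha => hY.1 ha.1
  have := ha.2.2
  rwa [image_vonNeumann_inter, h2 a ha.2.1 _ Set.inter_subset_right] at this

end Indescribability

section Square

open Order

theorem CoherentNClubs.piIndesc_eq {n : ℕ} {kappa : Ordinal.{0}}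
    {C : Ordinal.{0} → Set Ordinal.{0}} (hC : CoherentNClubs (n + 1) kappa C)
    {S : Set Ordinal.{0}} (hS : S ⊆ TrSet n kappa) {b : Ordinal.{0}} (hb : b < kappa)
    (h : PiIndesc (n + 1) (S ∩ Set.Iio b) b) :
    ∃ a ∈ S, C a = C b ∩ Set.Iio a := by
  have hbT : b ∈ TrSet n kappa := ⟨hb, h.pred.piIndCard⟩
  obtain ⟨a, ⟨⟨haS, hab⟩, ha⟩, -⟩ :=
    (h.reflect_piIndesc (hC.1 b hbT).1).exists_gt (pos_of_isSuccLimit h.piIndCard.isSuccLimit)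
  exact ⟨a, haS, hC.2 a (hS haS) b hbT hab ha⟩

/-- A set agreeing with the coherent sequence at a `Π¹ₙ₊₁`-indescribable set of points is a
thread. -/
theorem CoherentNClubs.isThread {n : ℕ} {kappa : Ordinal.{0}}
    {C : Ordinal.{0} → Set Ordinal.{0}} (hC : CoherentNClubs (n + 1) kappa C)
    {D : Set Ordinal.{0}} (hD : D ⊆ Set.Iio kappa)
    (h : PiIndesc (n + 1) {a ∈ TrSet n kappa | C a = D ∩ Set.Iio a} kappa) :
    IsThread (n + 1) kappa C D := by
  have hcut : ∀ {a b : Ordinal.{0}}, b < a → C a = D ∩ Set.Iio a →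
      C a ∩ Set.Iio b = D ∩ Set.Iio b := fun hba he => by
    rw [he, Set.inter_assoc, Set.inter_eq_right.2 (Set.Iio_subset_Iio hba.le)]
  refine ⟨⟨⟨hD, fun A hA phi hphi hs => ?_⟩, fun b hb hbi hbD => ?_⟩, fun b hb hbD => ?_⟩
  · obtain ⟨a, ⟨ha, he⟩, hsa⟩ := h.2 A hA phi hphi.mono hs
    obtain ⟨x, hx, hsx⟩ := (hC.1 a ha).1.2 _ Set.inter_subset_right phi hphi hsa
    rw [Vrank_inter ((hC.1 a ha).1.1 hx).le] at hsx
    rw [he] at hx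
    exact ⟨x, hx.1, hsx⟩
  · obtain ⟨a, ⟨ha, he⟩, hba⟩ := h.exists_gt hb
    have := (hC.1 a ha).2 b hba hbi (by rwa [hcut hba he])
    rw [he] at this
    exact this.1
  · obtain ⟨a, ⟨ha, he⟩, hba⟩ := h.exists_gt hb.1
    rw [← hcut hba he]
    exact hC.2 b hb a ha hba (by rwa [hcut hba he])

theorem piIndesc_trSet {n : ℕ} {kappa : Ordinal.{0}} (h : PiIndCard (n + 1) kappa) :
    PiIndesc (n + 1) (TrSet n kappa) kappa :=
  (h.reflect_piIndesc h.pred).mono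
    (fun _ ha => ⟨ha.1, ha.2.piIndCard⟩) fun _ ha => ha.1

theorem exists_of_not_piIndesc {n : ℕ} {X : Set Ordinal.{0}} {g : Ordinal.{0}}
    (hX : X ⊆ Set.Iio g) (h : ¬ PiIndesc n X g) : ∃ (A : Set ZFSet.{0}) (phi : SOForm),
      A ⊆ Vrank g ∧ IsPiForm n phi ∧ SOSatS (Vrank g) A phi ∧
        ∀ a ∈ X, ¬ SOSatS (Vrank a) (A ∩ Vrank a) phi := by
  by_contra! hcon
  exact h ⟨hX, fun A hA phi hphi hs => hcon A phi hA hphi hs⟩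

/-- Uniformization: if for every `δ` one of the two sets `{γ ∈ Y : δ ∈ C_γ}`, `{γ ∈ Y : δ ∉ C_γ}`
is null, then `C` is constant modulo initial segments on a large set. -/
theorem PiIndesc.exists_uniform {n : ℕ} {kappa : Ordinal.{0}} {Y : Set Ordinal.{0}}
    (hY : PiIndesc (n + 1) Y kappa) {C : Ordinal.{0} → Set Ordinal.{0}}
    (hC : ∀ a ∈ Y, C a ⊆ Set.Iio a)
    (h : ∀ d, ¬ (PiIndesc (n + 1) {a ∈ Y | d < a ∧ d ∈ C a} kappa ∧
      PiIndesc (n + 1) {a ∈ Y | d < a ∧ d ∉ C a} kappa)) :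
    ∃ D ⊆ Set.Iio kappa, PiIndesc (n + 1) {a ∈ Y | C a = D ∩ Set.Iio a} kappa := by
  let E := {d | PiIndesc (n + 1) {a ∈ Y | d < a ∧ d ∈ C a} kappa}
  have key : ∀ d, ∃ (A : Set ZFSet.{0}) (phi : SOForm), A ⊆ Vrank kappa ∧
      IsPiForm (n + 1) phi ∧ SOSatS (Vrank kappa) A phi ∧ ∀ a ∈ Y, d < a →
        SOSatS (Vrank a) (A ∩ Vrank a) phi → (d ∈ C a ↔ d ∈ E) := by
    intro d
    by_cases hd : d ∈ E
    · obtain ⟨A, phi, hA, hphi, hs, H⟩ := exists_of_not_piIndesc (fun a ha => hY.1 ha.1)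
        fun h' => h d ⟨hd, h'⟩
      refine ⟨A, phi, hA, hphi, hs, fun a ha hda hsa => iff_of_true ?_ hd⟩
      by_contra hcon
      exact H a ⟨ha, hda, hcon⟩ hsa
    · obtain ⟨A, phi, hA, hphi, hs, H⟩ := exists_of_not_piIndesc (fun a ha => hY.1 ha.1) hd
      exact ⟨A, phi, hA, hphi, hs, fun a ha hda hsa =>
        iff_of_false (fun hcon => H a ⟨ha, hda, hcon⟩ hsa) hd⟩
  choose A phi hA hphi hs hiff using key
  refine ⟨E ∩ Set.Iio kappa, Set.inter_subset_right, (hY.reflect_family hphi (A := A)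
    fun d _ => ?_).mono (fun a ha => ⟨ha.1, ?_⟩) fun _ ha => hY.1 ha.1⟩
  · rw [Set.inter_eq_left.2 (hA d)]
    exact hs d
  · ext d
    constructor
    · intro hd
      have hda := hC a ha.1 hd
      exact ⟨⟨(hiff d a ha.1 hda (ha.2.2 d hda)).1 hd,
        Set.Iio_subset_Iio (le_of_lt (hY.1 ha.1)) hda⟩, hda⟩
    · rintro ⟨⟨hd, -⟩, hda⟩
      exact (hiff d a ha.1 hda (ha.2.2 d hda)).2 hd

end Square

/-- Cody–Gitman–Lambie-Hanson. If `1 ≤ n < ω`, `κ` is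
`Π¹ₙ`-indescribable, and `□ₙ(κ)` holds, then there are two `Π¹ₙ`-indescribable sets
`S₀, S₁ ⊆ κ` which do not reflect simultaneously. -/
theorem squareN_no_simultaneous_reflection (n : ℕ) (hn : 1 ≤ n)
    (kappa : Ordinal.{0}) (hreg : RegUncountable kappa)
    (hind : PiIndCard n kappa) (hsq : SquareN n kappa) :
    ∃ S0 S1 : Set Ordinal.{0}, PiIndesc n S0 kappa ∧ PiIndesc n S1 kappa ∧
      ¬ ∃ beta < kappa, PiIndesc n (S0 ∩ Set.Iio beta) beta ∧
        PiIndesc n (S1 ∩ Set.Iio beta) beta := by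
  obtain ⟨m, rfl⟩ := Nat.exists_eq_add_of_le' hn
  obtain ⟨C, hC, hthread⟩ := hsq
  have hT := piIndesc_trSet hind
  by_cases h : ∃ d, PiIndesc (m + 1) {a ∈ TrSet m kappa | d < a ∧ d ∈ C a} kappa ∧
      PiIndesc (m + 1) {a ∈ TrSet m kappa | d < a ∧ d ∉ C a} kappa
  · obtain ⟨d, h0, h1⟩ := h
    refine ⟨_, _, h0, h1, ?_⟩
    rintro ⟨b, hb, hb0, hb1⟩
    obtain ⟨a, ⟨-, hda, hd⟩, he⟩ := hC.piIndesc_eq (fun _ ha => ha.1) hb hb0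
    obtain ⟨a', ⟨-, hda', hd'⟩, he'⟩ := hC.piIndesc_eq (fun _ ha => ha.1) hb hb1
    rw [he] at hd
    rw [he'] at hd'
    exact hd' ⟨hd.1, hda'⟩
  · push Not at h
    obtain ⟨D, hD, hind'⟩ := hT.exists_uniform (fun a ha => (hC.1 a ha).1.1)
      fun d hd => h d hd.1 hd.2
    exact (hthread D (hC.isThread hD hind')).elim

end LCI
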